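/- Let 𝒲 be the space of hypersurfaces of degree 2M in ℙ^M, M ≥ 5, and 𝒲_reg ⊂ 𝒲 the subset of hypersurfaces satisfying condition (W1) at every non-singular point and condition (W2) at every singular point. Then 𝒲_reg is Zariski open and codim((𝒲 \ 𝒲_reg) ⊂ 𝒲) ≥ (M−4)(M−1)/2. -/

import Mathlib

/-!
Shared elementary framework: the Zariski topology on a complex vector space,
dimension of subsets (topological Krull dimension), rank of quadratic forms,
and the space 𝒫^sing of polynomials `f = q₂ + q₃ + ⋯ + q_M`.
-/

noncomputable section

open MvPolynomial

/-- A polynomial function on a complex vector space: a polynomial expression in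
finitely many linear functionals. -/
def IsPolyFun {E : Type*} [AddCommGroup E] [Module ℂ E] (g : E → ℂ) : Prop :=
  ∃ (n : ℕ) (φ : E →ₗ[ℂ] (Fin n → ℂ)) (p : MvPolynomial (Fin n) ℂ),
    ∀ v, g v = MvPolynomial.eval (φ v) p

/-- Zariski-closed subsets of a complex vector space: common zero loci of families
of polynomial functions. -/
def IsZClosed {E : Type*} [AddCommGroup E] [Module ℂ E] (A : Set E) : Prop :=
  ∃ G : Set (E → ℂ), (∀ g ∈ G, IsPolyFun g) ∧ A = {v | ∀ g ∈ G, g v = 0}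

/-- The Zariski topology on a complex vector space. -/
def zariskiTopology (E : Type*) [AddCommGroup E] [Module ℂ E] : TopologicalSpace E :=
  TopologicalSpace.generateFrom {U | IsZClosed Uᶜ}

/-- A subset is Zariski open. -/
def IsZOpen {E : Type*} [AddCommGroup E] [Module ℂ E] (A : Set E) : Prop :=
  @IsOpen E (zariskiTopology E) A

/-- The dimension of a subset of a complex vector space: the topological Krull
dimension in the induced Zariski topology. -/
def zdim {E : Type*} [AddCommGroup E] [Module ℂ E] (A : Set E) : WithBot ℕ∞ :=
  @topologicalKrullDim A (TopologicalSpace.induced Subtype.val (zariskiTopology E))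

/-- The Zariski closure of a subset of a complex vector space. -/
def zclosure {E : Type*} [AddCommGroup E] [Module ℂ E] (A : Set E) : Set E :=
  @closure E (zariskiTopology E) A

/-- The rank of the quadratic form `q` on a subset `A ⊆ ℂ^n`: the least number of
squares of linear forms expressing `q` on `A` (over `ℂ` this is the rank of the
restriction of `q`). -/
def rankOn {n : ℕ} (q : MvPolynomial (Fin n) ℂ) (A : Set (Fin n → ℂ)) : ℕ :=
  sInf {r : ℕ | ∃ l : Fin r → ((Fin n → ℂ) →ₗ[ℂ] ℂ),
    ∀ z ∈ A, MvPolynomial.eval z q = ∑ i, l i z ^ 2}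

/-- The space 𝒫^sing of polynomials `f = q₂ + q₃ + ⋯ + q_M` in `M` variables:
polynomials of total degree at most `M` whose homogeneous components of degree 0
and 1 vanish. -/
def Psing (M : ℕ) : Submodule ℂ (MvPolynomial (Fin M) ℂ) :=
  (MvPolynomial.restrictTotalDegree (Fin M) ℂ M) ⊓
    (LinearMap.ker (MvPolynomial.homogeneousComponent 0) ⊓
     LinearMap.ker (MvPolynomial.homogeneousComponent 1))

/-- The affine expansion of a homogeneous form `G` at a point `v` of the affine chart
`{z_j = 1}` (so `v j = 1`): substitute `z_j ↦ v_j` and `z_i ↦ v_i + t_i` for `i ≠ j`.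
Its homogeneous components are the terms `q_k` of the local affine equation at `v`. -/
def chartShift {N : ℕ} (G : MvPolynomial (Fin N) ℂ) (v : Fin N → ℂ) (j : Fin N) :
    MvPolynomial (Fin N) ℂ :=
  MvPolynomial.bind₁
    (fun i => if i = j then MvPolynomial.C (v i) else MvPolynomial.C (v i) + MvPolynomial.X i) G

/-- The `k`-th term of the local affine equation of `{G = 0}` at the point `v` of the
chart `{z_j = 1}`. -/
def chartComp {N : ℕ} (k : ℕ) (G : MvPolynomial (Fin N) ℂ) (v : Fin N → ℂ) (j : Fin N) :
    MvPolynomial (Fin N) ℂ :=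
  MvPolynomial.homogeneousComponent k (chartShift G v j)

/-- The space 𝒲 of hypersurfaces of degree `2M` in `ℙ^M` (as the space of
homogeneous forms of degree `2M` in `M+1` variables; codimensions of cone-invariant
subsets agree with those in the projectivisation). -/
abbrev WSpace (M : ℕ) := ↥(MvPolynomial.homogeneousSubmodule (Fin (M + 1)) ℂ (2 * M))

/-- Condition (W1) at a non-singular point `o ∈ W` (where `q₁ ≢ 0`): the rank of the
quadratic form `q₂|_{q₁=0}` is at least 2. Condition (W2) at a singular point
(`q₁ ≡ 0`): the rank of `q₂` is at least 4. `WRegular G` states that these hold at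
every point of the hypersurface `W = {G = 0}`, computed in every affine chart. -/
def WRegular {M : ℕ} (G : MvPolynomial (Fin (M + 1)) ℂ) : Prop :=
  ∀ (v : Fin (M + 1) → ℂ) (j : Fin (M + 1)), v j = 1 → MvPolynomial.eval v G = 0 →
    (chartComp 1 G v j ≠ 0 →
      2 ≤ rankOn (chartComp 2 G v j)
            {z : Fin (M + 1) → ℂ | z j = 0 ∧ MvPolynomial.eval z (chartComp 1 G v j) = 0}) ∧
    (chartComp 1 G v j = 0 →
      4 ≤ rankOn (chartComp 2 G v j) {z : Fin (M + 1) → ℂ | z j = 0})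

section PolyFun

variable {E : Type*} [AddCommGroup E] [Module ℂ E]

theorem IsPolyFun.of_fintype {ι : Type*} [Fintype ι] (φ : E →ₗ[ℂ] (ι → ℂ))
    (p : MvPolynomial ι ℂ) : IsPolyFun fun v => eval (φ v) p := by
  let e := Fintype.equivFin ι
  let χ : E →ₗ[ℂ] (Fin (Fintype.card ι) → ℂ) :=
    LinearMap.pi fun k => LinearMap.proj (e.symm k) ∘ₗ φ
  have hχ (v : E) : (χ v) ∘ e = φ v := by
    ext i
    simp [χ]
  refine ⟨_, χ, rename e p, fun v => ?_⟩
  rw [eval_rename, hχ]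

theorem IsPolyFun.const (c : ℂ) : IsPolyFun fun _ : E => c :=
  ⟨0, 0, C c, fun v => by simp⟩

theorem IsPolyFun.of_linear (φ : E →ₗ[ℂ] ℂ) : IsPolyFun fun v => φ v :=
  ⟨1, LinearMap.pi fun _ => φ, X 0, fun v => by simp⟩

theorem IsPolyFun.add {f g : E → ℂ} (hf : IsPolyFun f) (hg : IsPolyFun g) :
    IsPolyFun fun v => f v + g v := by
  obtain ⟨m, φ, p, hp⟩ := hf
  obtain ⟨n, ψ, q, hq⟩ := hg
  let χ : E →ₗ[ℂ] (Fin m ⊕ Fin n → ℂ) :=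
    LinearMap.pi (Sum.elim (fun i => LinearMap.proj i ∘ₗ φ) fun i => LinearMap.proj i ∘ₗ ψ)
  convert IsPolyFun.of_fintype χ (rename Sum.inl p + rename Sum.inr q) using 2 with v
  rw [map_add, eval_rename, eval_rename, hp, hq]
  congr 1

theorem IsPolyFun.mul {f g : E → ℂ} (hf : IsPolyFun f) (hg : IsPolyFun g) :
    IsPolyFun fun v => f v * g v := by
  obtain ⟨m, φ, p, hp⟩ := hf
  obtain ⟨n, ψ, q, hq⟩ := hg
  let χ : E →ₗ[ℂ] (Fin m ⊕ Fin n → ℂ) :=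
    LinearMap.pi (Sum.elim (fun i => LinearMap.proj i ∘ₗ φ) fun i => LinearMap.proj i ∘ₗ ψ)
  convert IsPolyFun.of_fintype χ (rename Sum.inl p * rename Sum.inr q) using 2 with v
  rw [map_mul, eval_rename, eval_rename, hp, hq]
  congr 1

variable (E) in
/-- The algebra of polynomial functions on a complex vector space. -/
def polyFunAlgebra : Subalgebra ℂ (E → ℂ) where
  carrier := {g | IsPolyFun g}
  mul_mem' hf hg := hf.mul hg
  add_mem' hf hg := hf.add hg
  algebraMap_mem' c := IsPolyFun.const c

theorem IsPolyFun.sum {ι : Type*} {s : Finset ι} {f : ι → E → ℂ}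
    (hf : ∀ i ∈ s, IsPolyFun (f i)) : IsPolyFun fun v => ∑ i ∈ s, f i v := by
  have : (∑ i ∈ s, f i) ∈ polyFunAlgebra E := sum_mem hf
  convert (show IsPolyFun (∑ i ∈ s, f i) from this) using 1
  ext v
  simp

theorem IsPolyFun.prod {ι : Type*} {s : Finset ι} {f : ι → E → ℂ}
    (hf : ∀ i ∈ s, IsPolyFun (f i)) : IsPolyFun fun v => ∏ i ∈ s, f i v := by
  have : (∏ i ∈ s, f i) ∈ polyFunAlgebra E := prod_mem hf
  convert (show IsPolyFun (∏ i ∈ s, f i) from this) using 1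
  ext v
  simp

theorem IsPolyFun.det {n : Type*} [Fintype n] [DecidableEq n] {A : E → Matrix n n ℂ}
    (hA : ∀ i j, IsPolyFun fun v => A v i j) : IsPolyFun fun v => (A v).det := by
  simp only [Matrix.det_apply']
  refine IsPolyFun.sum (f := fun σ v => ((Equiv.Perm.sign σ : ℤ) : ℂ) * ∏ i, A v (σ i) i)
    fun σ _ => ?_
  have h : IsPolyFun fun v => ∏ i, A v (σ i) i :=
    IsPolyFun.prod (f := fun i v => A v (σ i) i) fun i _ => hA _ _
  exact (IsPolyFun.const ((Equiv.Perm.sign σ : ℤ) : ℂ)).mul h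

theorem IsPolyFun.exists_coord {ι : Type*} [Fintype ι] (b : Module.Basis ι ℂ E) {g : E → ℂ}
    (hg : IsPolyFun g) : ∃ p : MvPolynomial ι ℂ, ∀ v, g v = aeval (b.equivFun v) p := by
  obtain ⟨n, φ, p, hp⟩ := hg
  refine ⟨bind₁ (fun i => ∑ k, C (φ (b k) i) * X k) p, fun v => ?_⟩
  rw [hp, aeval_bind₁]
  have : φ v = fun i => aeval (b.equivFun v) (∑ k, C (φ (b k) i) * X k : MvPolynomial ι ℂ) := by
    ext i
    conv_lhs => rw [← b.sum_equivFun v, map_sum]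
    simp [mul_comm]
  rw [this]
  rfl

end PolyFun

section Zariski

variable {E : Type*} [AddCommGroup E] [Module ℂ E]

theorem IsZClosed.union {A B : Set E} (hA : IsZClosed A) (hB : IsZClosed B) :
    IsZClosed (A ∪ B) := by
  obtain ⟨S, hS, rfl⟩ := hA
  obtain ⟨T, hT, rfl⟩ := hB
  refine ⟨{h | ∃ f ∈ S, ∃ g ∈ T, h = fun v => f v * g v}, ?_, ?_⟩
  · rintro _ ⟨f, hf, g, hg, rfl⟩
    exact (hS f hf).mul (hT g hg)
  · ext v
    simp only [Set.mem_union, Set.mem_ofPred_eq]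
    constructor
    · rintro (h | h) _ ⟨f, hf, g, hg, rfl⟩
      · simp [h f hf]
      · simp [h g hg]
    · intro h
      by_contra! hv
      obtain ⟨⟨f, hf, hfv⟩, g, hg, hgv⟩ := hv
      exact mul_ne_zero hfv hgv (h _ ⟨f, hf, g, hg, rfl⟩)

theorem IsZClosed.sInter {𝒜 : Set (Set E)} (h : ∀ A ∈ 𝒜, IsZClosed A) : IsZClosed (⋂₀ 𝒜) := by
  refine ⟨{g | IsPolyFun g ∧ ∃ A ∈ 𝒜, ∀ v ∈ A, g v = 0}, fun g hg => hg.1, ?_⟩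
  ext v
  simp only [Set.mem_sInter, Set.mem_ofPred_eq]
  constructor
  · rintro hv g ⟨-, A, hA, hg⟩
    exact hg v (hv A hA)
  · intro hv A hA
    obtain ⟨S, hS, rfl⟩ := h A hA
    exact fun g hg => hv g ⟨hS g hg, _, hA, fun w hw => hw g hg⟩

theorem isClosed_zariski_iff {A : Set E} :
    @IsClosed E (zariskiTopology E) A ↔ IsZClosed A := by
  constructor
  · intro h
    have key : ∀ U : Set E, TopologicalSpace.GenerateOpen {U : Set E | IsZClosed Uᶜ} U →
        IsZClosed Uᶜ := by
      intro U hU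
      induction hU with
      | basic s hs => exact hs
      | univ => exact ⟨{fun _ => 1}, by rintro _ rfl; exact IsPolyFun.const 1, by ext; simp⟩
      | inter s t _ _ hs ht => rw [Set.compl_inter]; exact hs.union ht
      | sUnion 𝒮 _ h =>
        rw [Set.compl_sUnion]
        refine IsZClosed.sInter ?_
        rintro _ ⟨s, hs, rfl⟩
        exact h s hs
    simpa using key Aᶜ (@IsClosed.isOpen_compl _ (zariskiTopology E) _ h)
  · intro h
    let _ := zariskiTopology E
    refine ⟨TopologicalSpace.GenerateOpen.basic _ ?_⟩
    simpa using h

variable {N : ℕ} (b : Module.Basis (Fin N) ℂ E)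

/-- The ideal of polynomials in coordinates vanishing on a set. -/
def coordIdeal (Z : Set E) : Ideal (MvPolynomial (Fin N) ℂ) :=
  vanishingIdeal ℂ (b.equivFun '' Z)

theorem mem_coordIdeal {Z : Set E} {p : MvPolynomial (Fin N) ℂ} :
    p ∈ coordIdeal b Z ↔ ∀ v ∈ Z, aeval (b.equivFun v) p = 0 := by
  simp [coordIdeal]

theorem isZClosed_coord (p : MvPolynomial (Fin N) ℂ) :
    IsZClosed {v : E | aeval (b.equivFun v) p = 0} := by
  have h : IsPolyFun fun v : E => aeval (b.equivFun v) p :=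
    IsPolyFun.of_fintype b.equivFun.toLinearMap p
  exact ⟨{fun v => aeval (b.equivFun v) p}, fun g hg => hg ▸ h, by simp⟩

theorem coordIdeal_closure (Z : Set E) : coordIdeal b (zclosure Z) = coordIdeal b Z := by
  ext p
  rw [mem_coordIdeal, mem_coordIdeal]
  refine ⟨fun h v hv => h v (@subset_closure _ (zariskiTopology E) _ _ hv), fun h v hv => ?_⟩
  exact @closure_minimal _ (zariskiTopology E) _ _ (fun w hw => h w hw)
    (isClosed_zariski_iff.2 (isZClosed_coord b p)) v hv

theorem mem_of_coordIdeal {Z : Set E} (hZ : @IsClosed E (zariskiTopology E) Z) {v : E}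
    (h : ∀ p ∈ coordIdeal b Z, aeval (b.equivFun v) p = 0) : v ∈ Z := by
  obtain ⟨S, hS, rfl⟩ := isClosed_zariski_iff.1 hZ
  intro g hg
  obtain ⟨p, hp⟩ := (hS g hg).exists_coord b
  rw [hp]
  refine h p ((mem_coordIdeal b).2 fun w hw => ?_)
  rw [← hp]
  exact hw g hg

theorem coordIdeal_lt {Z W : Set E} (hZ : @IsClosed E (zariskiTopology E) Z)
    (h : Z ⊂ W) : coordIdeal b W < coordIdeal b Z := by
  refine lt_of_le_not_ge (vanishingIdeal_anti_mono (Set.image_mono h.1)) fun hle => h.2 ?_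
  intro v hv
  exact mem_of_coordIdeal b hZ fun p hp => (mem_coordIdeal b).1 (hle hp) v hv

theorem coordIdeal_isPrime {Z : Set E} (hZ : @IsIrreducible E (zariskiTopology E) Z) :
    (coordIdeal b Z).IsPrime := by
  let _ := zariskiTopology E
  refine Ideal.isPrime_iff.2 ⟨fun h => ?_, fun {p q} hpq => ?_⟩
  · obtain ⟨v, hv⟩ := hZ.nonempty
    have := (mem_coordIdeal b).1 (h ▸ Submodule.mem_top : (1 : MvPolynomial _ ℂ) ∈ _) v hv
    simp at this
  · have hc := isPreirreducible_iff_isClosed_union_isClosed.1 hZ.isPreirreducible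
      _ _ (isClosed_zariski_iff.2 (isZClosed_coord b p))
      (isClosed_zariski_iff.2 (isZClosed_coord b q)) fun v hv => by
        have := (mem_coordIdeal b).1 hpq v hv
        simpa using this
    exact hc.imp (fun h => (mem_coordIdeal b).2 h) fun h => (mem_coordIdeal b).2 h

end Zariski

section Dimension

theorem ringKrullDim_le_of_integral {R S : Type*} [CommRing R] [CommRing S] (f : R →+* S)
    (hf : f.IsIntegral) : ringKrullDim S ≤ ringKrullDim R := by
  algebraize [f]
  refine Order.krullDim_le_of_strictMono (PrimeSpectrum.comap f) fun I J h => ?_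
  exact Ideal.IsIntegral.comap_lt_comap (R := R) (I := I.asIdeal) (J := J.asIdeal) h

theorem ringKrullDim_quotient_ker_le {m N : ℕ}
    (f : MvPolynomial (Fin N) ℂ →ₐ[ℂ] MvPolynomial (Fin m) ℂ) :
    ringKrullDim (MvPolynomial (Fin N) ℂ ⧸ RingHom.ker f) ≤ m := by
  obtain ⟨s, -, g, hg, hint⟩ := exists_integral_inj_algHom_of_quotient (RingHom.ker f)
    (RingHom.ker_ne_top f)
  refine (ringKrullDim_le_of_integral g.toRingHom hint).trans ?_
  rw [AlgHom.toRingHom_eq_coe] at *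
  have h := trdeg_le_of_injective ((Ideal.kerLiftAlg f).comp g)
    ((Ideal.kerLiftAlg_injective f).comp hg)
  rw [MvPolynomial.trdeg_of_isDomain, MvPolynomial.trdeg_of_isDomain] at h
  simp only [Cardinal.mk_fin, Cardinal.lift_natCast, Nat.cast_le] at h
  rw [MvPolynomial.ringKrullDim_of_isNoetherianRing, ringKrullDim_eq_zero_of_field]
  simpa using h

end Dimension

section Cover

variable {E : Type*} [AddCommGroup E] [Module ℂ E]

theorem exists_ker_le_coordIdeal_range {P : Type*} [AddCommGroup P] [Module ℂ P]
    [FiniteDimensional ℂ P] {N : ℕ} (b : Module.Basis (Fin N) ℂ E) {F : P → E}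
    (hF : ∀ φ : E →ₗ[ℂ] ℂ, IsPolyFun fun v => φ (F v)) :
    ∃ f : MvPolynomial (Fin N) ℂ →ₐ[ℂ] MvPolynomial (Fin (Module.finrank ℂ P)) ℂ,
      RingHom.ker f ≤ coordIdeal b (Set.range F) := by
  have h := fun i => (hF (b.coord i)).exists_coord (Module.finBasis ℂ P)
  choose p hp using h
  refine ⟨aeval p, fun q hq => (mem_coordIdeal b).2 ?_⟩
  rintro _ ⟨v, rfl⟩
  have h1 : b.equivFun (F v) = fun i => aeval ((Module.finBasis ℂ P).equivFun v) (p i) := by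
    ext i
    rw [← hp]
    simp
  have h2 : aeval p q = 0 := hq
  rw [h1, ← aeval_bind₁]
  simp only [bind₁, h2, map_zero]

theorem zdim_le_of_subset_iUnion_range [FiniteDimensional ℂ E] {κ : Type*} [Finite κ] {P : κ → Type*}
    [∀ k, AddCommGroup (P k)] [∀ k, Module ℂ (P k)] [∀ k, FiniteDimensional ℂ (P k)]
    (F : ∀ k, P k → E) (hF : ∀ k, ∀ φ : E →ₗ[ℂ] ℂ, IsPolyFun fun v => φ (F k v))
    {B : Set E} (hB : B ⊆ ⋃ k, Set.range (F k)) {d : ℕ}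
    (hd : ∀ k, Module.finrank ℂ (P k) ≤ d) : zdim B ≤ d := by
  classical
  have := Fintype.ofFinite κ
  let _ := zariskiTopology E
  let b := Module.finBasis ℂ E
  refine iSup_le fun s => ?_
  have hind : Topology.IsInducing (Subtype.val : B → E) := ⟨rfl⟩
  let Φ := TopologicalSpace.IrreducibleCloseds.map (Subtype.val : B → E) hind.continuous
  have hΦ : StrictMono Φ := TopologicalSpace.IrreducibleCloseds.map_strictMono_of_isInducing hind
  obtain ⟨k, hk⟩ : ∃ k, (Φ s.last : Set E) ⊆ closure (Set.range (F k)) := by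
    have hsub : (Φ s.last : Set E) ⊆ ⋃ k, closure (Set.range (F k)) := by
      rw [← closure_iUnion_of_finite]
      refine closure_mono ((Set.image_subset_range _ _).trans ?_)
      simpa using hB
    obtain ⟨Z, hZ, hle⟩ := isIrreducible_iff_sUnion_isClosed.1 (Φ s.last).isIrreducible
      (Finset.univ.image fun k => closure (Set.range (F k)))
      (by simp) (by simpa using hsub)
    obtain ⟨k, -, rfl⟩ := Finset.mem_image.1 hZ
    exact ⟨k, hle⟩
  obtain ⟨f, hf⟩ := exists_ker_le_coordIdeal_range b (hF k)
  have hmem (i) : RingHom.ker f ≤ coordIdeal b (Φ (s i) : Set E) := by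
    refine hf.trans ?_
    rw [← coordIdeal_closure]
    refine vanishingIdeal_anti_mono (Set.image_mono (Set.Subset.trans ?_ hk))
    exact hΦ.monotone (LTSeries.monotone s (Fin.le_last i))
  let t : LTSeries (PrimeSpectrum.zeroLocus
      (RingHom.ker f : Set (MvPolynomial (Fin (Module.finrank ℂ E)) ℂ))) :=
    { length := s.length
      toFun := fun i => ⟨⟨coordIdeal b (Φ (s i.rev)), coordIdeal_isPrime b (Φ _).isIrreducible⟩,
        (PrimeSpectrum.mem_zeroLocus _ _).2 (hmem i.rev)⟩
      step := fun i => by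
        refine coordIdeal_lt b (Φ _).isClosed (hΦ (s.strictMono ?_))
        simp [Fin.rev_lt_rev] }
  calc (s.length : WithBot ℕ∞) = t.length := rfl
    _ ≤ Order.krullDim (PrimeSpectrum.zeroLocus
        (RingHom.ker f : Set (MvPolynomial (Fin (Module.finrank ℂ E)) ℂ))) :=
      le_iSup (fun t : LTSeries _ => (t.length : WithBot ℕ∞)) t
    _ ≤ Module.finrank ℂ (P k) := by
      rw [← ringKrullDim_quotient]
      exact ringKrullDim_quotient_ker_le f
    _ ≤ d := by exact_mod_cast hd k

end Cover

section PolyMap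

variable {E : Type*} [AddCommGroup E] [Module ℂ E] {σ : Type*}

/-- A map from a vector space to a polynomial ring all of whose coefficients are polynomial
functions. -/
def IsPolyMap (F : E → MvPolynomial σ ℂ) : Prop :=
  ∀ α, IsPolyFun fun e => coeff α (F e)

theorem IsPolyMap.const (p : MvPolynomial σ ℂ) : IsPolyMap fun _ : E => p :=
  fun _ => IsPolyFun.const _

theorem IsPolyMap.add {F G : E → MvPolynomial σ ℂ} (hF : IsPolyMap F) (hG : IsPolyMap G) :
    IsPolyMap fun e => F e + G e := fun α => by
  simp only [coeff_add]
  exact (hF α).add (hG α)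

theorem IsPolyMap.mul {F G : E → MvPolynomial σ ℂ} (hF : IsPolyMap F) (hG : IsPolyMap G) :
    IsPolyMap fun e => F e * G e := fun α => by
  classical
  simp only [coeff_mul]
  exact IsPolyFun.sum (f := fun (x : (σ →₀ ℕ) × (σ →₀ ℕ)) e => coeff x.1 (F e) * coeff x.2 (G e))
    fun x _ => (hF x.1).mul (hG x.2)

variable (E σ) in
/-- The algebra of polynomial maps to a polynomial ring. -/
def polyMapAlgebra : Subalgebra ℂ (E → MvPolynomial σ ℂ) where
  carrier := {F | IsPolyMap F}
  mul_mem' hF hG := hF.mul hG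
  add_mem' hF hG := hF.add hG
  algebraMap_mem' c := IsPolyMap.const (C c)

theorem IsPolyMap.sum {ι : Type*} {s : Finset ι} {F : ι → E → MvPolynomial σ ℂ}
    (hF : ∀ i ∈ s, IsPolyMap (F i)) : IsPolyMap fun e => ∑ i ∈ s, F i e := by
  have : (∑ i ∈ s, F i) ∈ polyMapAlgebra E σ := sum_mem hF
  convert (show IsPolyMap (∑ i ∈ s, F i) from this) using 1
  ext1 e
  simp

theorem IsPolyMap.prod {ι : Type*} {s : Finset ι} {F : ι → E → MvPolynomial σ ℂ}
    (hF : ∀ i ∈ s, IsPolyMap (F i)) : IsPolyMap fun e => ∏ i ∈ s, F i e := by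
  have : (∏ i ∈ s, F i) ∈ polyMapAlgebra E σ := prod_mem hF
  convert (show IsPolyMap (∏ i ∈ s, F i) from this) using 1
  ext1 e
  simp

theorem IsPolyMap.pow {F : E → MvPolynomial σ ℂ} (hF : IsPolyMap F) (k : ℕ) :
    IsPolyMap fun e => F e ^ k := by
  simpa using IsPolyMap.prod (s := Finset.range k) (F := fun _ => F) fun _ _ => hF

theorem IsPolyMap.of_linear (f : E →ₗ[ℂ] MvPolynomial σ ℂ) : IsPolyMap fun e => f e :=
  fun α => IsPolyFun.of_linear (lcoeff ℂ α ∘ₗ f)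

theorem IsPolyMap.C_comp {g : E → ℂ} (hg : IsPolyFun g) :
    IsPolyMap fun e => (C (g e) : MvPolynomial σ ℂ) := fun α => by
  classical
  simp only [coeff_C]
  by_cases h : 0 = α
  · simpa [h] using hg
  · simpa [h] using IsPolyFun.const 0

theorem IsPolyMap.pderiv {F : E → MvPolynomial σ ℂ} (hF : IsPolyMap F) (i : σ) :
    IsPolyMap fun e => pderiv i (F e) := fun α => by
  simp only [coeff_pderiv]
  exact (hF _).mul (IsPolyFun.const _)

theorem IsPolyMap.homogeneousComponent {F : E → MvPolynomial σ ℂ} (hF : IsPolyMap F) (d : ℕ) :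
    IsPolyMap fun e => homogeneousComponent d (F e) := fun α => by
  simp only [coeff_homogeneousComponent]
  by_cases h : α.degree = d
  · simpa [h] using hF α
  · simpa [h] using IsPolyFun.const 0

theorem IsPolyMap.det {n : Type*} [Fintype n] [DecidableEq n]
    {A : E → Matrix n n (MvPolynomial σ ℂ)} (hA : ∀ i j, IsPolyMap fun e => A e i j) :
    IsPolyMap fun e => (A e).det := by
  simp only [Matrix.det_apply']
  refine IsPolyMap.sum (F := fun τ e => ((Equiv.Perm.sign τ : ℤ) : MvPolynomial σ ℂ) *
    ∏ i, A e (τ i) i) fun τ _ => ?_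
  have h : IsPolyMap fun e => ∏ i, A e (τ i) i :=
    IsPolyMap.prod (F := fun i e => A e (τ i) i) fun i _ => hA _ _
  exact (IsPolyMap.const ((Equiv.Perm.sign τ : ℤ) : MvPolynomial σ ℂ)).mul h

theorem IsPolyMap.bind₁ {τ : Type*} {g : E → σ → MvPolynomial τ ℂ}
    (hg : ∀ i, IsPolyMap fun e => g e i) {F : E → MvPolynomial σ ℂ} (hF : IsPolyMap F)
    (S : Finset (σ →₀ ℕ)) (hS : ∀ e, (F e).support ⊆ S) :
    IsPolyMap fun e => bind₁ (g e) (F e) := by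
  have h (e : E) : MvPolynomial.bind₁ (g e) (F e) =
      ∑ α ∈ S, C (coeff α (F e)) * ∏ i ∈ α.support, g e i ^ α i := by
    change aeval (g e) (F e) = _
    rw [aeval_def, eval₂_eq]
    refine Finset.sum_subset (hS e) fun α _ hα => ?_
    rw [notMem_support_iff.1 hα]
    simp
  simp only [h]
  refine IsPolyMap.sum (F := fun (α : σ →₀ ℕ) e =>
    C (coeff α (F e)) * ∏ i ∈ α.support, g e i ^ α i) fun α _ => ?_
  have h' : IsPolyMap fun e => ∏ i ∈ α.support, g e i ^ α i :=
    IsPolyMap.prod (F := fun i e => g e i ^ α i) fun i _ => (hg i).pow _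
  exact (IsPolyMap.C_comp (hF α)).mul h'

end PolyMap

section Elimination

theorem coeff_aeval_C_mul_X {σ : Type*} (z : σ → ℂ) (p : MvPolynomial σ ℂ) (k : ℕ) :
    (aeval (fun i => Polynomial.C (z i) * Polynomial.X) p).coeff k =
      eval z (homogeneousComponent k p) := by
  induction p using MvPolynomial.induction_on' with
  | monomial α c =>
    have h : aeval (fun i => Polynomial.C (z i) * Polynomial.X) (monomial α c) =
        Polynomial.C (eval z (monomial α c)) * Polynomial.X ^ α.degree := by
      rw [aeval_monomial, eval_monomial, Finsupp.prod, Finsupp.prod, map_mul, map_prod,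
        Finsupp.degree_apply, ← Finset.prod_pow_eq_pow_sum, mul_assoc, ← Finset.prod_mul_distrib]
      congr 1
      exact Finset.prod_congr rfl fun i _ => by rw [mul_pow, map_pow]
    rw [h, Polynomial.coeff_C_mul, Polynomial.coeff_X_pow]
    have hm := isHomogeneous_monomial c (rfl : α.degree = α.degree)
    rw [homogeneousComponent_of_mem hm]
    split_ifs <;> simp
  | add p q hp hq => simp [hp, hq]

theorem aeval_C_mul_X_of_isHomogeneous {σ : Type*} {p : MvPolynomial σ ℂ} {d : ℕ}
    (hp : p.IsHomogeneous d) (z : σ → ℂ) :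
    aeval (fun i => Polynomial.C (z i) * Polynomial.X) p =
      Polynomial.C (eval z p) * Polynomial.X ^ d := by
  ext k
  rw [coeff_aeval_C_mul_X, homogeneousComponent_of_mem hp, Polynomial.coeff_C_mul,
    Polynomial.coeff_X_pow]
  split_ifs <;> simp

theorem eval_homogeneousComponent_mul {σ : Type*}
    {p : MvPolynomial σ ℂ} {d : ℕ} (hp : p.IsHomogeneous d) {z : σ → ℂ} (hz : eval z p = 0)
    (c : MvPolynomial σ ℂ) (k : ℕ) : eval z (homogeneousComponent k (c * p)) = 0 := by
  rw [← coeff_aeval_C_mul_X, map_mul, aeval_C_mul_X_of_isHomogeneous hp, hz]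
  simp

theorem eval_eq_sum_of_isHomogeneous {n D : ℕ} {p : MvPolynomial (Fin n) ℂ}
    (hp : p.IsHomogeneous D) (z : Fin n → ℂ) :
    eval z p = ∑ β : (Finset.univ : Finset (Fin n)).finsuppAntidiag D,
      coeff β.1 p * ∏ i, z i ^ β.1 i := by
  rw [eval_eq', Finset.sum_coe_sort (Finset.finsuppAntidiag Finset.univ D)
    (fun β => coeff β p * ∏ i, z i ^ β i)]
  refine Finset.sum_subset (fun α hα => ?_) fun α _ hα => ?_
  · rw [Finset.mem_finsuppAntidiag]
    have h : Finsupp.weight (fun _ => 1) α = D := hp (mem_support_iff.1 hα)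
    rw [← Finsupp.degree_eq_weight_one] at h
    exact ⟨by rw [← h, Finsupp.degree_eq_sum], Finset.subset_univ _⟩
  · rw [notMem_support_iff.1 hα, zero_mul]

theorem exists_monomial_mem_span {n : ℕ} {𝔄 : Type*} (f : 𝔄 → MvPolynomial (Fin n) ℂ)
    (hf : ∀ v : Fin n → ℂ, (∀ a, eval v (f a) = 0) → v = 0) :
    ∃ D : ℕ, 0 < D ∧ ∀ α : Fin n →₀ ℕ, α.degree = D →
      monomial α 1 ∈ Ideal.span (Set.range f) := by
  set I := Ideal.span (Set.range f)
  have hX (i : Fin n) : ∃ k : ℕ, (X i : MvPolynomial (Fin n) ℂ) ^ k ∈ I := by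
    have : (X i : MvPolynomial (Fin n) ℂ) ∈ I.radical := by
      rw [← vanishingIdeal_zeroLocus_eq_radical (K := ℂ), mem_vanishingIdeal_iff]
      intro v hv
      have hv0 : v = 0 := hf v fun a => by
        simpa [aeval_eq_eval] using hv (f a) (Ideal.subset_span ⟨a, rfl⟩)
      simp [hv0]
    exact this
  choose k hk using hX
  refine ⟨∑ i, k i + 1, Nat.succ_pos _, fun α hα => ?_⟩
  obtain ⟨i, hi⟩ : ∃ i, k i ≤ α i := by
    by_contra! h
    have := Finset.sum_le_sum fun i (_ : i ∈ Finset.univ) => (h i).le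
    rw [Finsupp.degree_eq_sum] at hα
    omega
  have h : (monomial α 1 : MvPolynomial (Fin n) ℂ) =
      monomial (α - Finsupp.single i (k i)) 1 * X i ^ k i := by
    rw [X_pow_eq_monomial, monomial_mul, one_mul, tsub_add_cancel_of_le]
    simpa using hi
  rw [h]
  exact I.mul_mem_left _ (hk i)

/-- The main theorem of elimination theory: properness of projective space. -/
theorem isZClosed_exists_common_zero {E : Type*} [AddCommGroup E] [Module ℂ E] {n : ℕ}
    {𝔄 : Type*} {F : 𝔄 → E → MvPolynomial (Fin n) ℂ} (hF : ∀ a, IsPolyMap (F a)) {d : 𝔄 → ℕ}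
    (hd : ∀ a e, (F a e).IsHomogeneous (d a)) :
    IsZClosed {e | ∃ v : Fin n → ℂ, v ≠ 0 ∧ ∀ a, eval v (F a e) = 0} := by
  set Z := {e | ∃ v : Fin n → ℂ, v ≠ 0 ∧ ∀ a, eval v (F a e) = 0}
  refine ⟨{g | IsPolyFun g ∧ ∀ e ∈ Z, g e = 0}, fun g hg => hg.1,
    Set.Subset.antisymm (fun e he g hg => hg.2 e he) fun e₀ he₀ => ?_⟩
  by_contra hZ
  obtain ⟨D, hD, hmem⟩ := exists_monomial_mem_span (fun a => F a e₀) fun v hv => by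
    by_contra h
    exact hZ ⟨v, h, hv⟩
  let T := (Finset.univ : Finset (Fin n)).finsuppAntidiag D
  have hT (α : T) : α.1.degree = D := by
    rw [Finsupp.degree_eq_sum]
    exact (Finset.mem_finsuppAntidiag.1 α.2).1
  have hc (α : T) := (Finsupp.mem_ideal_span_range_iff_exists_finsupp).1 (hmem α.1 (hT α))
  choose c hc using hc
  let P (α : T) (e : E) : MvPolynomial (Fin n) ℂ :=
    ∑ a ∈ (c α).support, homogeneousComponent D (c α a * F a e)
  have hP (α : T) : IsPolyMap (P α) :=
    IsPolyMap.sum (F := fun a e => homogeneousComponent D (c α a * F a e)) fun a _ =>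
      ((IsPolyMap.const (c α a)).mul (hF a)).homogeneousComponent D
  have hPD (α : T) (e : E) : (P α e).IsHomogeneous D :=
    IsHomogeneous.sum _ _ _ fun a _ => homogeneousComponent_isHomogeneous _ _
  have hP₀ (α : T) : P α e₀ = monomial α.1 1 := by
    change ∑ a ∈ (c α).support, homogeneousComponent D (c α a * F a e₀) = _
    rw [← map_sum]
    have := hc α
    rw [Finsupp.sum] at this
    rw [this, homogeneousComponent_of_mem (isHomogeneous_monomial 1 (hT α)), if_pos rfl]
  let A (e : E) : Matrix T T ℂ := Matrix.of fun α β => coeff β.1 (P α e)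
  have hA₀ : A e₀ = 1 := by
    ext α β
    change coeff β.1 (P α e₀) = _
    rw [hP₀, coeff_monomial, Matrix.one_apply]
    exact if_congr Subtype.ext_iff.symm rfl rfl
  have hdet : (A e₀).det = 0 := by
    refine he₀ (fun e => (A e).det) ⟨IsPolyFun.det fun α β => hP α β.1, ?_⟩
    rintro e ⟨v, hv, hve⟩
    obtain ⟨i, hi⟩ := Function.ne_iff.1 hv
    have hiT : Finsupp.single i D ∈ T := by
      rw [Finset.mem_finsuppAntidiag]
      exact ⟨by rw [← Finsupp.degree_eq_sum, Finsupp.degree_single], Finset.subset_univ _⟩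
    refine Matrix.exists_mulVec_eq_zero_iff.1
      ⟨fun β : T => ∏ i, v i ^ β.1 i, fun h => ?_, ?_⟩
    · have := congrFun h ⟨_, hiT⟩
      simp only [Pi.zero_apply, Finset.prod_eq_zero_iff] at this
      obtain ⟨k, _, hk⟩ := this
      rcases eq_or_ne k i with rfl | hki
      · rw [Finsupp.single_eq_same] at hk
        exact hi (eq_zero_of_pow_eq_zero hk)
      · simp [hki.symm] at hk
    · ext α
      have := eval_eq_sum_of_isHomogeneous (hPD α e) v
      rw [Pi.zero_apply, Matrix.mulVec, dotProduct]
      refine this.symm.trans ?_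
      rw [map_sum]
      exact Finset.sum_eq_zero fun a _ => eval_homogeneousComponent_mul (hd a e) (hve a) _ _
  rw [hA₀, Matrix.det_one] at hdet
  exact one_ne_zero hdet

end Elimination

section SumOfSquares

variable {V : Type*} [AddCommGroup V] [Module ℂ V]

/-- The quadratic form of `B` is a sum of `r` squares of linear forms on the subspace `W`. -/
def IsSumSqOn (B : LinearMap.BilinForm ℂ V) (W : Submodule ℂ V) (r : ℕ) : Prop :=
  ∃ l : Fin r → (V →ₗ[ℂ] ℂ), ∀ z ∈ W, B z z = ∑ i, l i z ^ 2

theorem IsSumSqOn.of_fintype {B : LinearMap.BilinForm ℂ V} {W : Submodule ℂ V} {r : ℕ}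
    {ι : Type*} [Fintype ι] (hr : Fintype.card ι ≤ r) (l : ι → (W →ₗ[ℂ] ℂ))
    (hl : ∀ z : W, B z z = ∑ i, l i z ^ 2) : IsSumSqOn B W r := by
  obtain ⟨e⟩ : Nonempty (ι ↪ Fin r) :=
    Function.Embedding.nonempty_of_card_le (by simpa using hr)
  choose l' hl' using fun i => LinearMap.exists_extend (l i)
  refine ⟨Function.extend e l' 0, fun z hz => ?_⟩
  rw [hl ⟨z, hz⟩]
  refine Fintype.sum_of_injective e e.injective _ _ (fun k hk => ?_) fun i => ?_
  · rw [Function.extend_apply' _ _ _ fun h => hk h]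
    simp
  · rw [e.injective.extend_apply, ← hl' i]
    rfl

theorem IsSumSqOn.mono {B : LinearMap.BilinForm ℂ V} {W W' : Submodule ℂ V} {r r' : ℕ}
    (h : IsSumSqOn B W r) (hW : W' ≤ W) (hr : r ≤ r') : IsSumSqOn B W' r' := by
  obtain ⟨l, hl⟩ := h
  exact .of_fintype (by simpa using hr) (fun i => l i ∘ₗ W'.subtype) fun z => hl z (hW z.2)

theorem IsSumSqOn.det_eq_zero {B : LinearMap.BilinForm ℂ V} (hB : B.IsSymm) {W : Submodule ℂ V}
    {r : ℕ} (h : IsSumSqOn B W r) {x y : Fin (r + 1) → V} (hx : ∀ i, x i ∈ W)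
    (hy : ∀ i, y i ∈ W) : (Matrix.of fun i j => B (x i) (y j)).det = 0 := by
  obtain ⟨l, hl⟩ := h
  have hpol {a b : V} (ha : a ∈ W) (hb : b ∈ W) : B a b = ∑ i, l i a * l i b := by
    have h1 := hl _ (W.add_mem ha hb)
    have h2 : B a b = B b a := hB.eq a b
    simp only [map_add, LinearMap.add_apply, hl a ha, hl b hb, ← h2, add_sq,
      Finset.sum_add_distrib] at h1
    have h3 : ∑ i, 2 * l i a * l i b = 2 * ∑ i, l i a * l i b := by
      simp only [mul_assoc, Finset.mul_sum]
    rw [h3] at h1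
    linear_combination h1 / 2
  have hmul : (Matrix.of fun i j => B (x i) (y j)) =
      (Matrix.of fun i k => l k (x i)) * (Matrix.of fun k j => l k (y j)) := by
    ext i j
    rw [Matrix.mul_apply]
    exact hpol (hx i) (hy j)
  by_contra hdet
  have hu := Matrix.rank_of_isUnit _ ((Matrix.isUnit_iff_isUnit_det _).2 (isUnit_iff_ne_zero.2 hdet))
  rw [hmul] at hu
  have h1 := (Matrix.rank_mul_le_left (Matrix.of fun i k => l k (x i))
    (Matrix.of fun k j => l k (y j))).trans (Matrix.rank_le_width _)
  rw [hu, Fintype.card_fin] at h1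
  omega

theorem exists_diagonal [FiniteDimensional ℂ V] {B : LinearMap.BilinForm ℂ V} (hB : B.IsSymm) :
    ∃ b : Module.Basis (Fin (Module.finrank ℂ V)) ℂ V, (∀ i j, i ≠ j → B (b i) (b j) = 0) ∧
      ∀ z, B z z = ∑ i, B (b i) (b i) * (b.repr z i) ^ 2 := by
  let _ : Invertible (2 : ℂ) := invertibleOfNonzero two_ne_zero
  obtain ⟨b, hb⟩ := LinearMap.BilinForm.exists_orthogonal_basis (B := B) ⟨hB.eq⟩
  have hb' : ∀ i j, i ≠ j → B (b i) (b j) = 0 := fun i j hij => hb hij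
  refine ⟨b, hb', fun z => ?_⟩
  conv_lhs => rw [← b.sum_repr z]
  simp only [map_sum, LinearMap.sum_apply, map_smul, LinearMap.smul_apply, smul_eq_mul]
  refine Finset.sum_congr rfl fun i _ => ?_
  rw [Finset.sum_eq_single i (fun j _ hj => by rw [hb' j i hj]; simp) (by simp)]
  ring

theorem isSumSqOn_finrank [FiniteDimensional ℂ V] {B : LinearMap.BilinForm ℂ V} (hB : B.IsSymm)
    (W : Submodule ℂ V) : ∃ r, IsSumSqOn B W r := by
  obtain ⟨b, -, hb⟩ := exists_diagonal (B := B.restrict W) (hB.restrict W)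
  choose s hs using fun i => IsAlgClosed.exists_pow_nat_eq (B.restrict W (b i) (b i)) two_pos
  refine ⟨_, .of_fintype le_rfl (fun i => s i • b.coord i) fun z => (hb z).trans ?_⟩
  exact Finset.sum_congr rfl fun i _ => by simp [mul_pow, hs]

theorem isSumSqOn_of_det_eq_zero [FiniteDimensional ℂ V] {B : LinearMap.BilinForm ℂ V}
    (hB : B.IsSymm) {W : Submodule ℂ V} {r : ℕ}
    (h : ∀ x : Fin (r + 1) → V, (∀ i, x i ∈ W) → (Matrix.of fun i j => B (x i) (x j)).det = 0) :
    IsSumSqOn B W r := by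
  classical
  obtain ⟨b, hb, hbz⟩ := exists_diagonal (B := B.restrict W) (hB.restrict W)
  let S := {i // B.restrict W (b i) (b i) ≠ 0}
  have hS : Fintype.card S ≤ r := by
    by_contra! hr
    obtain ⟨e⟩ : Nonempty (Fin (r + 1) ↪ S) :=
      Function.Embedding.nonempty_of_card_le (by simpa using hr)
    have hd : (Matrix.of fun i j => B (b (e i)) (b (e j))) =
        Matrix.diagonal fun i => B (b (e i)) (b (e i)) := by
      ext i j
      rcases eq_or_ne i j with rfl | hij
      · simp
      · rw [Matrix.diagonal_apply_ne _ hij]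
        exact hb _ _ fun h => hij (e.injective (Subtype.ext h))
    have h0 := h (fun i => b (e i)) fun i => (b (e i)).2
    rw [hd, Matrix.det_diagonal, Finset.prod_eq_zero_iff] at h0
    obtain ⟨i, _, hi⟩ := h0
    exact (e i).2 hi
  choose s hs using fun i => IsAlgClosed.exists_pow_nat_eq (B.restrict W (b i) (b i)) two_pos
  refine .of_fintype hS (fun i => s i • b.coord i) fun z => (hbz z).trans ?_
  symm
  refine Fintype.sum_of_injective (fun i : S => i.1) Subtype.val_injective _ _ (fun k hk => ?_)
    fun i => by simp [mul_pow, hs]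
  have : B.restrict W (b k) (b k) = 0 := by
    by_contra h
    exact hk ⟨⟨k, h⟩, rfl⟩
  rw [this, zero_mul]

theorem rankOn_le_iff {n : ℕ} {B : LinearMap.BilinForm ℂ (Fin n → ℂ)} (hB : B.IsSymm)
    {q : MvPolynomial (Fin n) ℂ} {A : Set (Fin n → ℂ)} {W : Submodule ℂ (Fin n → ℂ)}
    (hA : A = W) (hq : ∀ z ∈ W, eval z q = B z z) {r : ℕ} :
    rankOn q A ≤ r ↔ IsSumSqOn B W r := by
  subst hA
  have hset : {r : ℕ | ∃ l : Fin r → ((Fin n → ℂ) →ₗ[ℂ] ℂ),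
      ∀ z ∈ (W : Set (Fin n → ℂ)), eval z q = ∑ i, l i z ^ 2} = {r | IsSumSqOn B W r} := by
    ext r
    refine exists_congr fun l => forall₂_congr fun z hz => ?_
    rw [hq z hz]
  rw [rankOn, hset]
  refine ⟨fun h => ?_, fun h => Nat.sInf_le h⟩
  have h0 : IsSumSqOn B W (sInf {r | IsSumSqOn B W r}) := Nat.sInf_mem (isSumSqOn_finrank hB W)
  exact h0.mono le_rfl h

end SumOfSquares

section NormalForm

/-- If `B` has rank at most `3` and `v` is an isotropic vector with `B v = κ L`, `κ ≠ 0`,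
then `B` has rank at most `1` on the kernel of `L`. -/
theorem isSumSqOn_ker_of_isSumSqOn_top {V : Type*} [AddCommGroup V] [Module ℂ V]
    [FiniteDimensional ℂ V] {B : LinearMap.BilinForm ℂ V} (hB : B.IsSymm) {L : V →ₗ[ℂ] ℂ}
    {v : V} {κ : ℂ} (hκ : κ ≠ 0) (hBv : ∀ y, B v y = κ * L y) (hLv : L v = 0) (hL : L ≠ 0)
    (h : IsSumSqOn B ⊤ 3) : IsSumSqOn B (LinearMap.ker L) 1 := by
  obtain ⟨u, hu⟩ : ∃ u, L u ≠ 0 := by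
    by_contra! h'
    exact hL (LinearMap.ext h')
  refine isSumSqOn_of_det_eq_zero hB fun x hx => ?_
  have hx0 : L (x 0) = 0 := hx 0
  have hx1 : L (x 1) = 0 := hx 1
  have hBv' (y : V) : B y v = κ * L y := by rw [← hBv]; exact hB.eq y v
  have hd := h.det_eq_zero hB (x := ![x 0, x 1, u, v]) (y := ![x 0, x 1, u, v])
    (fun _ => trivial) fun _ => trivial
  have hd' : (κ * L u) ^ 2 * (B (x 0) (x 0) * B (x 1) (x 1) - B (x 0) (x 1) * B (x 1) (x 0)) =
      0 := by
    simp [Matrix.det_succ_row_zero, Fin.sum_univ_succ, Fin.succAbove, hBv, hBv', hx0, hx1, hLv]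
      at hd
    linear_combination -hd
  rw [Matrix.det_fin_two]
  exact (mul_eq_zero.1 hd').resolve_left (pow_ne_zero _ (mul_ne_zero hκ hu))

variable {n : ℕ}

theorem eq_zero_of_single_eq_zero {v : Fin n → ℂ} {j : Fin n} (hv : v j = 1)
    {L : (Fin n → ℂ) →ₗ[ℂ] ℂ} (hLv : L v = 0)
    (h : ∀ i, i ≠ j → L (Pi.single i 1) = 0) : L = 0 := by
  have hsum (z : Fin n → ℂ) : L z = z j * L (Pi.single j 1) := by
    conv_lhs => rw [pi_eq_sum_univ' z]
    rw [map_sum, Finset.sum_eq_single j (fun i _ hi => by rw [map_smul]; simp [h i hi]) (by simp),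
      map_smul, smul_eq_mul]
  have hj : L (Pi.single j 1) = 0 := by simpa [hv, hLv] using (hsum v).symm
  ext1 i
  rcases eq_or_ne i j with rfl | hi
  · ext
    simp [hj]
  · ext
    simp [h i hi]

/-- The quadratic form of `B` can be written as `a² + L m` with `a` and `L` vanishing at `v`,
`m v ∈ {0, 1}` and `a` not involving some coordinate other than the `j`-th one. -/
def HasNormalForm (B : LinearMap.BilinForm ℂ (Fin n → ℂ)) (v : Fin n → ℂ) (j : Fin n) : Prop :=
  ∃ (i : Fin n) (ε : Fin 2) (a L m : (Fin n → ℂ) →ₗ[ℂ] ℂ), i ≠ j ∧ a v = 0 ∧ L v = 0 ∧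
    m v = (ε : ℕ) ∧ a (Pi.single i 1) = 0 ∧ ∀ z, B z z = a z ^ 2 + L z * m z

theorem HasNormalForm.isSumSqOn {B : LinearMap.BilinForm ℂ (Fin n → ℂ)} {v : Fin n → ℂ}
    {j : Fin n} (h : HasNormalForm B v j) : IsSumSqOn B ⊤ 3 := by
  obtain ⟨_, _, a, L, m, -, -, -, -, -, h⟩ := h
  refine ⟨![a, (2⁻¹ : ℂ) • (L + m), (Complex.I / 2) • (L - m)], fun z _ => ?_⟩
  rw [h]
  simp [Fin.sum_univ_succ]
  linear_combination (-(L z - m z) ^ 2 / 4) * Complex.I_sq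

theorem hasNormalForm_of_ne_zero {B : LinearMap.BilinForm ℂ (Fin n → ℂ)} {v : Fin n → ℂ}
    {j : Fin n} (hv : v j = 1) {a L m : (Fin n → ℂ) →ₗ[ℂ] ℂ} (ε : Fin 2) (ha : a v = 0)
    (hLv : L v = 0) (hm : m v = (ε : ℕ)) (h : ∀ z, B z z = a z ^ 2 + L z * m z) (hL : L ≠ 0) :
    HasNormalForm B v j := by
  obtain ⟨i, hij, hi⟩ : ∃ i, i ≠ j ∧ L (Pi.single i 1) ≠ 0 := by
    by_contra! h'
    exact hL (eq_zero_of_single_eq_zero hv hLv h')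
  set s := a (Pi.single i 1) / L (Pi.single i 1) with hs
  refine ⟨i, ε, a - s • L, L, m + (2 * s) • (a - s • L) + s ^ 2 • L, hij, by simp [ha, hLv], hLv,
    by simp [ha, hLv, hm], ?_, fun z => ?_⟩
  · simp [hs, hi]
  · rw [h]
    simp
    ring

theorem hasNormalForm_of_isSumSqOn_ker {B : LinearMap.BilinForm ℂ (Fin n → ℂ)} (hB : B.IsSymm)
    {v : Fin n → ℂ} {j : Fin n} (hv : v j = 1) {L : (Fin n → ℂ) →ₗ[ℂ] ℂ} {κ : ℂ} (hκ : κ ≠ 0)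
    (hBv : ∀ y, B v y = κ * L y) (hLv : L v = 0) (hL : L ≠ 0)
    (h : IsSumSqOn B (LinearMap.ker (LinearMap.proj j) ⊓ LinearMap.ker L) 1) :
    HasNormalForm B v j := by
  obtain ⟨u, huj, hu⟩ : ∃ u : Fin n → ℂ, u j = 0 ∧ L u = 1 := by
    obtain ⟨i, hij, hi⟩ : ∃ i, i ≠ j ∧ L (Pi.single i 1) ≠ 0 := by
      by_contra! h'
      exact hL (eq_zero_of_single_eq_zero hv hLv h')
    exact ⟨(L (Pi.single i 1))⁻¹ • Pi.single i 1, by simp [hij.symm], by simp [hi]⟩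
  obtain ⟨l, hl⟩ := h
  have hBv' (y : Fin n → ℂ) : B y v = κ * L y := by rw [← hBv]; exact hB.eq y v
  let π : (Fin n → ℂ) →ₗ[ℂ] ℂ := LinearMap.proj j
  let p : (Fin n → ℂ) →ₗ[ℂ] (Fin n → ℂ) := LinearMap.id - π.smulRight v - L.smulRight u
  have hp (z) : p z = z - z j • v - L z • u := rfl
  have hpv : p v = 0 := by simp [hp, hv, hLv]
  have hpj (z) : p z j = 0 := by simp [hp, hv, huj]
  have hpL (z) : L (p z) = 0 := by simp [hp, hLv, hu]
  have hpz (z) : B (p z) (p z) = l 0 (p z) ^ 2 := by simpa using hl (p z) ⟨hpj z, hpL z⟩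
  refine hasNormalForm_of_ne_zero hv (a := l 0 ∘ₗ p) (L := (2 * κ) • L)
    (m := (2 * κ)⁻¹ • ((2 : ℂ) • (B u ∘ₗ p) + (2 * κ) • π + B u u • L)) 1 (by simp [hpv])
    (by simp [hLv]) ?_ (fun z => ?_) ?_
  · simp [hpv, hLv, π, hv]
    field_simp
  · have hz : z = p z + (z j • v + L z • u) := by simp [hp]
    have hpu : B (p z) u = B u (p z) := hB.eq _ _
    have e1 : B z z = B (p z) (p z) + 2 * L z * B u (p z) + 2 * (z j * L z * κ)
        + L z ^ 2 * B u u := by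
      conv_lhs => rw [hz]
      simp only [map_add, LinearMap.add_apply, map_smul, LinearMap.smul_apply, smul_eq_mul, hBv,
        hBv', hpL, hLv, hu, hpu]
      ring
    rw [e1, hpz]
    simp [π]
    field_simp
    ring
  · exact smul_ne_zero (mul_ne_zero two_ne_zero hκ) hL

theorem hasNormalForm_of_isSumSqOn_three {B : LinearMap.BilinForm ℂ (Fin n → ℂ)} (hB : B.IsSymm)
    {v : Fin n → ℂ} {j : Fin n} (hn : 2 ≤ n) (hv : v j = 1) (hBv : ∀ y, B v y = 0)
    (h : IsSumSqOn B (LinearMap.ker (LinearMap.proj j)) 3) : HasNormalForm B v j := by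
  obtain ⟨l, hl⟩ := h
  have hBv' (y : Fin n → ℂ) : B y v = 0 := by rw [← hBv y]; exact hB.eq y v
  let π : (Fin n → ℂ) →ₗ[ℂ] ℂ := LinearMap.proj j
  let p : (Fin n → ℂ) →ₗ[ℂ] (Fin n → ℂ) := LinearMap.id - π.smulRight v
  have hp (z) : p z = z - z j • v := rfl
  have hpv : p v = 0 := by simp [hp, hv]
  have hpj (z) : p z j = 0 := by simp [hp, hv]
  let a (k : Fin 3) := l k ∘ₗ p
  have ha (k) : a k v = 0 := by simp [a, hpv]
  have hz (z) : B z z = a 2 z ^ 2 +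
      (a 0 + Complex.I • a 1) z * (a 0 - Complex.I • a 1) z := by
    have e1 : B z z = B (p z) (p z) := by simp [hp, hBv, hBv']
    rw [e1, hl (p z) (hpj z)]
    simp [Fin.sum_univ_succ, a]
    linear_combination (l 1 (p z)) ^ 2 * Complex.I_sq
  by_cases hL : a 0 + Complex.I • a 1 = 0
  · simp only [hL, LinearMap.zero_apply, zero_mul, add_zero] at hz
    have : Nontrivial (Fin n) := Fin.nontrivial_iff_two_le.2 hn
    obtain ⟨i, hij⟩ := exists_ne j
    exact ⟨i, 0, 0, a 2, a 2, hij, rfl, ha 2, by simp [ha], rfl, fun z => by rw [hz]; simp [sq]⟩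
  · exact hasNormalForm_of_ne_zero hv 0 (ha 2) (by simp [ha]) (by simp [ha]) hz hL

end NormalForm

section Jets

variable {n : ℕ}

/-- The differential of `G` at `v`. -/
def gradAt (G : MvPolynomial (Fin n) ℂ) (v : Fin n → ℂ) : (Fin n → ℂ) →ₗ[ℂ] ℂ :=
  ∑ i, eval v (pderiv i G) • LinearMap.proj i

/-- Half the Hessian of `G` at `v`. -/
def hessAt (G : MvPolynomial (Fin n) ℂ) (v : Fin n → ℂ) : LinearMap.BilinForm ℂ (Fin n → ℂ) :=
  Matrix.toBilin' (Matrix.of fun i k => eval v (pderiv i (pderiv k G)) / 2)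

theorem gradAt_apply (G : MvPolynomial (Fin n) ℂ) (v x : Fin n → ℂ) :
    gradAt G v x = ∑ i, x i * eval v (pderiv i G) := by
  simp [gradAt, mul_comm]

theorem hessAt_apply (G : MvPolynomial (Fin n) ℂ) (v x y : Fin n → ℂ) :
    hessAt G v x y = ∑ i, ∑ k, x i * (eval v (pderiv i (pderiv k G)) / 2) * y k := by
  simp [hessAt, Matrix.toBilin'_apply]

theorem pderiv_pderiv_comm (i k : Fin n) (G : MvPolynomial (Fin n) ℂ) :
    pderiv i (pderiv k G) = pderiv k (pderiv i G) := by
  rcases eq_or_ne i k with rfl | h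
  · rfl
  · ext m
    simp only [coeff_pderiv, Finsupp.add_apply, Finsupp.single_eq_of_ne h,
      Finsupp.single_eq_of_ne h.symm, add_right_comm m (Finsupp.single i 1)]
    push_cast
    ring

theorem hessAt_isSymm (G : MvPolynomial (Fin n) ℂ) (v : Fin n → ℂ) : (hessAt G v).IsSymm := by
  refine ⟨fun x y => ?_⟩
  rw [hessAt_apply, hessAt_apply, Finset.sum_comm]
  refine Finset.sum_congr rfl fun i _ => Finset.sum_congr rfl fun k _ => ?_
  rw [pderiv_pderiv_comm k i]
  ring

/-- The restriction of a polynomial to the line through `v` in the direction `x`. -/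
def lineEval (v x : Fin n → ℂ) : MvPolynomial (Fin n) ℂ →ₐ[ℂ] Polynomial ℂ :=
  aeval fun i => Polynomial.C (v i) + Polynomial.C (x i) * Polynomial.X

theorem lineEval_X (v x : Fin n → ℂ) (i : Fin n) :
    lineEval v x (X i) = Polynomial.C (v i) + Polynomial.C (x i) * Polynomial.X := by
  simp [lineEval]

theorem lineEval_coeff_zero (v x : Fin n → ℂ) (G : MvPolynomial (Fin n) ℂ) :
    (lineEval v x G).coeff 0 = eval v G := by
  induction G using MvPolynomial.induction_on with
  | C a => simp [lineEval]
  | add p q hp hq => simp [hp, hq]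
  | mul_X p i hp => simp [hp, lineEval_X]

theorem derivative_lineEval (v x : Fin n → ℂ) (G : MvPolynomial (Fin n) ℂ) :
    Polynomial.derivative (lineEval v x G) =
      ∑ k, Polynomial.C (x k) * lineEval v x (pderiv k G) := by
  induction G using MvPolynomial.induction_on with
  | C a => simp [lineEval]
  | add p q hp hq => simp [hp, hq, mul_add, Finset.sum_add_distrib]
  | mul_X p i hp =>
    have h1 : ∑ k, Polynomial.C (x k) * lineEval v x (pderiv k (X i)) = Polynomial.C (x i) := by
      rw [Finset.sum_eq_single i (fun b _ hb => by rw [pderiv_X_of_ne hb.symm]; simp) (by simp),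
        pderiv_X_self, map_one, mul_one]
    have h2 (k : Fin n) : Polynomial.C (x k) * lineEval v x (pderiv k (p * X i)) =
        lineEval v x p * (Polynomial.C (x k) * lineEval v x (pderiv k (X i))) +
          Polynomial.C (x k) * lineEval v x (pderiv k p) * lineEval v x (X i) := by
      rw [Derivation.leibniz, smul_eq_mul, smul_eq_mul, map_add, map_mul, map_mul]
      ring
    simp only [h2, Finset.sum_add_distrib, ← Finset.mul_sum, ← Finset.sum_mul]
    rw [h1, map_mul, Polynomial.derivative_mul, hp, lineEval_X]
    simp [add_comm]

theorem lineEval_coeff_one (v x : Fin n → ℂ) (G : MvPolynomial (Fin n) ℂ) :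
    (lineEval v x G).coeff 1 = gradAt G v x := by
  have h := congrArg (Polynomial.coeff · 0) (derivative_lineEval v x G)
  simpa [Polynomial.coeff_derivative, lineEval_coeff_zero, gradAt_apply] using h

theorem lineEval_coeff_two (v x : Fin n → ℂ) (G : MvPolynomial (Fin n) ℂ) :
    (lineEval v x G).coeff 2 = hessAt G v x x := by
  have h := congrArg (Polynomial.coeff · 1) (derivative_lineEval v x G)
  simp only [Polynomial.coeff_derivative, Polynomial.finsetSum_coeff, Polynomial.coeff_C_mul,
    lineEval_coeff_one, gradAt_apply, Finset.mul_sum] at h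
  rw [hessAt_apply, Finset.sum_comm]
  have h2 : ∑ y, ∑ x_1, x x_1 * (eval v (pderiv x_1 (pderiv y G)) / 2) * x y =
      (∑ k, ∑ i, x k * (x i * eval v (pderiv i (pderiv k G)))) / 2 := by
    simp only [Finset.sum_div]
    exact Finset.sum_congr rfl fun k _ => Finset.sum_congr rfl fun i _ => by ring
  rw [h2, ← h]
  push_cast
  ring

theorem eval_chartComp (k : ℕ) (G : MvPolynomial (Fin n) ℂ) (v : Fin n → ℂ) (j : Fin n)
    {z : Fin n → ℂ} (hz : z j = 0) :
    eval z (chartComp k G v j) = (lineEval v z G).coeff k := by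
  rw [chartComp, ← coeff_aeval_C_mul_X, chartShift, aeval_bind₁, lineEval]
  congr 3
  ext1 i
  rcases eq_or_ne i j with rfl | hi
  · simp [hz]
  · simp [hi, add_comm]

theorem eval_chartComp_update (k : ℕ) (G : MvPolynomial (Fin n) ℂ) (v : Fin n → ℂ) (j : Fin n)
    (z : Fin n → ℂ) :
    eval z (chartComp k G v j) = eval (Function.update z j 0) (chartComp k G v j) := by
  rw [chartComp, ← coeff_aeval_C_mul_X, ← coeff_aeval_C_mul_X, chartShift, aeval_bind₁,
    aeval_bind₁]
  congr 3
  ext1 i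
  rcases eq_or_ne i j with rfl | hi <;> simp [*]

variable {G : MvPolynomial (Fin n) ℂ} {d : ℕ}

theorem gradAt_self (hG : G.IsHomogeneous d) (v : Fin n → ℂ) : gradAt G v v = d * eval v G := by
  have h := congrArg (eval v) hG.sum_X_mul_pderiv
  simpa [gradAt_apply] using h

theorem two_mul_hessAt_self_left (hG : G.IsHomogeneous d) (v y : Fin n → ℂ) :
    2 * hessAt G v v y = (d - 1 : ℕ) * gradAt G v y := by
  have h (k : Fin n) := congrArg (eval v) (hG.pderiv (i := k)).sum_X_mul_pderiv
  simp only [map_sum, map_mul, eval_X, nsmul_eq_mul, map_natCast] at h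
  rw [hessAt_apply, gradAt_apply, Finset.sum_comm, Finset.mul_sum, Finset.mul_sum]
  refine Finset.sum_congr rfl fun k _ => ?_
  rw [← mul_left_comm, ← h k, Finset.mul_sum, Finset.mul_sum]
  exact Finset.sum_congr rfl fun i _ => by ring

theorem chartComp_one_eq_zero_iff {v : Fin n → ℂ} {j : Fin n} (hv : v j = 1)
    (hL : gradAt G v v = 0) : chartComp 1 G v j = 0 ↔ gradAt G v = 0 := by
  refine ⟨fun h => eq_zero_of_single_eq_zero hv hL fun i hi => ?_, fun h => ?_⟩
  · rw [← lineEval_coeff_one, ← eval_chartComp 1 G v j (by simp [hi.symm]), h, map_zero]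
  · refine MvPolynomial.funext fun z => ?_
    rw [eval_chartComp_update, eval_chartComp _ _ _ _ (by simp), lineEval_coeff_one, h]
    simp

/-- Regularity at a point of a hypersurface fails exactly when half the Hessian has rank at
most `3`, and then it admits a normal form. -/
theorem regular_iff {v : Fin n → ℂ} {j : Fin n} (hG : G.IsHomogeneous d) (hd : 2 ≤ d) (hn : 2 ≤ n)
    (hv : v j = 1) (hGv : eval v G = 0) :
    (((chartComp 1 G v j ≠ 0 → 2 ≤ rankOn (chartComp 2 G v j)
            {z : Fin n → ℂ | z j = 0 ∧ eval z (chartComp 1 G v j) = 0}) ∧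
    (chartComp 1 G v j = 0 → 4 ≤ rankOn (chartComp 2 G v j) {z : Fin n → ℂ | z j = 0})) ↔
      ¬ IsSumSqOn (hessAt G v) ⊤ 3) ∧
    (IsSumSqOn (hessAt G v) ⊤ 3 → HasNormalForm (hessAt G v) v j) := by
  have hB := hessAt_isSymm G v
  have hL : gradAt G v v = 0 := by rw [gradAt_self hG, hGv, mul_zero]
  have hκ : ((d - 1 : ℕ) : ℂ) / 2 ≠ 0 :=
    div_ne_zero (Nat.cast_ne_zero.2 (by omega)) two_ne_zero
  have hBv (y : Fin n → ℂ) : hessAt G v v y = ((d - 1 : ℕ) : ℂ) / 2 * gradAt G v y := by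
    linear_combination two_mul_hessAt_self_left hG v y / 2
  have hq (z : Fin n → ℂ) (hz : z j = 0) : eval z (chartComp 2 G v j) = hessAt G v z z := by
    rw [eval_chartComp _ _ _ _ hz, lineEval_coeff_two]
  have hr1 := rankOn_le_iff (r := 1) hB (q := chartComp 2 G v j)
    (A := {z : Fin n → ℂ | z j = 0 ∧ eval z (chartComp 1 G v j) = 0})
    (W := LinearMap.ker (LinearMap.proj j) ⊓ LinearMap.ker (gradAt G v))
    (by
      ext z
      simp only [Set.mem_ofPred_eq, SetLike.mem_coe, Submodule.mem_inf, LinearMap.mem_ker,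
        LinearMap.proj_apply]
      refine and_congr_right fun hz => ?_
      rw [eval_chartComp _ _ _ _ hz, lineEval_coeff_one]) fun z hz => hq z hz.1
  have hr3 := rankOn_le_iff (r := 3) hB (q := chartComp 2 G v j) (A := {z : Fin n → ℂ | z j = 0})
    (W := LinearMap.ker (LinearMap.proj j)) rfl fun z hz => hq z hz
  rw [chartComp_one_eq_zero_iff hv hL, ne_eq, chartComp_one_eq_zero_iff hv hL,
    ← not_lt, Nat.lt_succ_iff, hr1, ← not_lt, Nat.lt_succ_iff, hr3]
  by_cases h0 : gradAt G v = 0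
  · simp only [h0, not_true_eq_false, false_imp_iff, true_and, true_imp_iff, not_iff_not]
    have hnf := hasNormalForm_of_isSumSqOn_three hB hn hv fun y => by rw [hBv, h0]; simp
    exact ⟨⟨fun h => (hnf h).isSumSqOn, fun h => h.mono le_top le_rfl⟩,
      fun h => hnf (h.mono le_top le_rfl)⟩
  · simp only [h0, not_false_eq_true, true_imp_iff, false_imp_iff, and_true, not_iff_not]
    have hnf := hasNormalForm_of_isSumSqOn_ker hB hv hκ hBv hL h0
    have hker (h : IsSumSqOn (hessAt G v) ⊤ 3) :=
      (isSumSqOn_ker_of_isSumSqOn_top hB hκ hBv hL h0 h).mono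
        (inf_le_right (a := LinearMap.ker (LinearMap.proj j))) le_rfl
    exact ⟨⟨fun h => (hnf h).isSumSqOn, hker⟩, fun h => hnf (hker h)⟩

end Jets

section RegularLocus

variable {n : ℕ}

theorem eval_smul_of_isHomogeneous {p : MvPolynomial (Fin n) ℂ} {d : ℕ} (hp : p.IsHomogeneous d)
    (t : ℂ) (v : Fin n → ℂ) : eval (t • v) p = t ^ d * eval v p := by
  have h := congrArg (Polynomial.aeval t) (aeval_C_mul_X_of_isHomogeneous hp v)
  rw [comp_aeval_apply] at h
  simp only [map_mul, map_pow, Polynomial.aeval_X, Polynomial.aeval_C, Algebra.algebraMap_self,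
    RingHom.id_apply] at h
  rw [mul_comm, ← h, aeval_eq_eval]
  simp only [mul_comm (v _) t]
  rfl

/-- A minor of the Hessian of `G`. -/
def hessMinor {r : ℕ} (x y : Fin r → Fin n → ℂ) (G : MvPolynomial (Fin n) ℂ) :
    MvPolynomial (Fin n) ℂ :=
  (Matrix.of fun a b => ∑ i, ∑ k, C (x a i * y b k / 2) * pderiv i (pderiv k G)).det

theorem eval_hessMinor {r : ℕ} (x y : Fin r → Fin n → ℂ) (G : MvPolynomial (Fin n) ℂ)
    (v : Fin n → ℂ) :
    eval v (hessMinor x y G) = (Matrix.of fun a b => hessAt G v (x a) (y b)).det := by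
  rw [hessMinor, RingHom.map_det]
  congr 1
  ext a b
  simp only [RingHom.mapMatrix_apply, Matrix.map_apply, Matrix.of_apply, hessAt_apply, map_sum,
    map_mul, eval_C]
  exact Finset.sum_congr rfl fun i _ => Finset.sum_congr rfl fun k _ => by ring

theorem hessMinor_isHomogeneous {r : ℕ} (x y : Fin r → Fin n → ℂ) {G : MvPolynomial (Fin n) ℂ}
    {d : ℕ} (hG : G.IsHomogeneous d) : (hessMinor x y G).IsHomogeneous (r * (d - 1 - 1)) := by
  rw [hessMinor, Matrix.det_apply]
  refine IsHomogeneous.sum _ _ _ fun τ _ => ?_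
  have h : (∏ a, Matrix.of (fun a b => ∑ i, ∑ k, C (x a i * y b k / 2) *
      pderiv i (pderiv k G)) (τ a) a).IsHomogeneous (∑ _a : Fin r, (d - 1 - 1)) := by
    refine IsHomogeneous.prod _ _ _ fun a _ => ?_
    rw [Matrix.of_apply]
    refine IsHomogeneous.sum _ _ _ fun i _ => IsHomogeneous.sum _ _ _ fun k _ => ?_
    simpa using (isHomogeneous_C (Fin n) (x (τ a) i * y a k / 2)).mul
      (hG.pderiv (i := k)).pderiv
  rw [Finset.sum_const, Finset.card_fin, smul_eq_mul] at h
  rcases Int.units_eq_one_or (Equiv.Perm.sign τ) with hs | hs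
  · rw [hs, one_smul]
    exact h
  · rw [hs, Units.neg_smul, one_smul]
    exact h.neg

theorem isPolyMap_hessMinor {E : Type*} [AddCommGroup E] [Module ℂ E] {r : ℕ}
    (x y : Fin r → Fin n → ℂ) {F : E → MvPolynomial (Fin n) ℂ} (hF : IsPolyMap F) :
    IsPolyMap fun e => hessMinor x y (F e) := by
  refine IsPolyMap.det (A := fun e => Matrix.of fun a b =>
    ∑ i, ∑ k, C (x a i * y b k / 2) * pderiv i (pderiv k (F e))) fun a b => ?_
  simp only [Matrix.of_apply]
  refine IsPolyMap.sum (F := fun i e => ∑ k, C (x a i * y b k / 2) * pderiv i (pderiv k (F e)))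
    fun i _ => ?_
  refine IsPolyMap.sum (F := fun k e => C (x a i * y b k / 2) * pderiv i (pderiv k (F e)))
    fun k _ => ?_
  exact (IsPolyMap.const _).mul ((hF.pderiv k).pderiv i)

theorem isSumSqOn_hessAt_iff (G : MvPolynomial (Fin n) ℂ) (v : Fin n → ℂ) (r : ℕ) :
    IsSumSqOn (hessAt G v) ⊤ r ↔
      ∀ x y : Fin (r + 1) → Fin n → ℂ, eval v (hessMinor x y G) = 0 := by
  simp only [eval_hessMinor]
  exact ⟨fun h x y => h.det_eq_zero (hessAt_isSymm G v) (fun _ => trivial) fun _ => trivial,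
    fun h => isSumSqOn_of_det_eq_zero (hessAt_isSymm G v) fun x _ => h x x⟩

variable {M : ℕ} {G : MvPolynomial (Fin (M + 1)) ℂ}

theorem not_wRegular_iff (hM : 1 ≤ M) (hG : G.IsHomogeneous (2 * M)) :
    ¬ WRegular G ↔ ∃ (v : Fin (M + 1) → ℂ) (j : Fin (M + 1)), v j = 1 ∧ eval v G = 0 ∧
      IsSumSqOn (hessAt G v) ⊤ 3 := by
  rw [WRegular]
  simp only [not_forall, exists_prop]
  refine exists_congr fun v => exists_congr fun j => and_congr_right fun hv =>
    and_congr_right fun hGv => ?_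
  have h := (regular_iff hG (by omega) (by omega) hv hGv).1
  rw [← not_iff_not, not_not] at h
  simpa only [not_and, not_forall, exists_prop] using h

theorem not_wRegular_iff_exists_ne_zero (hM : 1 ≤ M) (hG : G.IsHomogeneous (2 * M)) :
    ¬ WRegular G ↔ ∃ v : Fin (M + 1) → ℂ, v ≠ 0 ∧
      ∀ a : Option ((Fin 4 → Fin (M + 1) → ℂ) × (Fin 4 → Fin (M + 1) → ℂ)),
        eval v (a.elim G fun xy => hessMinor xy.1 xy.2 G) = 0 := by
  rw [not_wRegular_iff hM hG]
  simp only [Option.forall, Option.elim_none, Option.elim_some, isSumSqOn_hessAt_iff, Prod.forall]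
  constructor
  · rintro ⟨v, j, hv, h⟩
    exact ⟨v, fun h0 => by simp [h0] at hv, h⟩
  · rintro ⟨v, hv, h1, h2⟩
    obtain ⟨j, hj⟩ := Function.ne_iff.1 hv
    refine ⟨(v j)⁻¹ • v, j, inv_mul_cancel₀ hj, ?_, fun x y => ?_⟩
    · rw [eval_smul_of_isHomogeneous hG, h1, mul_zero]
    · rw [eval_smul_of_isHomogeneous (hessMinor_isHomogeneous x y hG), h2, mul_zero]

theorem isZClosed_not_wRegular (hM : 1 ≤ M) :
    IsZClosed {W : WSpace M | ¬ WRegular (W : MvPolynomial (Fin (M + 1)) ℂ)} := by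
  have hid : IsPolyMap fun W : WSpace M => (W : MvPolynomial (Fin (M + 1)) ℂ) :=
    IsPolyMap.of_linear (homogeneousSubmodule (Fin (M + 1)) ℂ (2 * M)).subtype
  have h := isZClosed_exists_common_zero (E := WSpace M)
    (F := fun (a : Option ((Fin 4 → Fin (M + 1) → ℂ) × (Fin 4 → Fin (M + 1) → ℂ))) W =>
      a.elim (W : MvPolynomial (Fin (M + 1)) ℂ) fun xy => hessMinor xy.1 xy.2 W)
    (d := fun a => a.elim (2 * M) fun _ => 4 * (2 * M - 1 - 1))
    (by
      rintro (_ | xy)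
      · exact hid
      · exact isPolyMap_hessMinor xy.1 xy.2 hid)
    (by
      rintro (_ | xy) W
      · exact W.2
      · exact hessMinor_isHomogeneous xy.1 xy.2 W.2)
  convert h using 1
  ext W
  exact not_wRegular_iff_exists_ne_zero hM W.2

theorem isZOpen_wRegular (hM : 1 ≤ M) :
    IsZOpen {W : WSpace M | WRegular (W : MvPolynomial (Fin (M + 1)) ℂ)} :=
  TopologicalSpace.GenerateOpen.basic _ (isZClosed_not_wRegular hM)

end RegularLocus

section Shear

variable {n : ℕ}

/-- The substitution `X k ↦ X k + w k X j`. -/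
def shear (j : Fin n) (w : Fin n → ℂ) : MvPolynomial (Fin n) ℂ →ₐ[ℂ] MvPolynomial (Fin n) ℂ :=
  bind₁ fun k => X k + C (w k) * X j

theorem shear_X (j : Fin n) (w : Fin n → ℂ) (k : Fin n) :
    shear j w (X k) = X k + C (w k) * X j := by
  simp [shear]

theorem shear_neg_shear {j : Fin n} {w : Fin n → ℂ} (hw : w j = 0) (G : MvPolynomial (Fin n) ℂ) :
    shear j (-w) (shear j w G) = G := by
  have h : (shear j (-w)).comp (shear j w) = AlgHom.id ℂ _ := by
    ext1 k
    rw [AlgHom.comp_apply, shear_X, map_add, map_mul, shear_X, shear_X, algHom_C]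
    simp [hw]
  exact DFunLike.congr_fun h G

theorem shear_isHomogeneous (j : Fin n) (w : Fin n → ℂ) {G : MvPolynomial (Fin n) ℂ} {d : ℕ}
    (hG : G.IsHomogeneous d) : (shear j w G).IsHomogeneous d := by
  have h := hG.aeval (fun k => X k + C (w k) * X j) (n := 1) fun k =>
    (isHomogeneous_X ℂ k).add (by simpa using (isHomogeneous_C _ (w k)).mul (isHomogeneous_X ℂ j))
  rw [one_mul] at h
  exact h

theorem lineEval_shear (j : Fin n) (w v x : Fin n → ℂ) (G : MvPolynomial (Fin n) ℂ) :
    lineEval v x (shear j w G) = lineEval (v + v j • w) (x + x j • w) G := by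
  have h : (lineEval v x).comp (shear j w) = lineEval (v + v j • w) (x + x j • w) := by
    ext1 k
    rw [AlgHom.comp_apply, shear_X, map_add, map_mul, lineEval_X, lineEval_X, lineEval_X, algHom_C]
    simp only [Pi.add_apply, Pi.smul_apply, smul_eq_mul, map_add, map_mul, Polynomial.algebraMap_eq]
    ring
  exact DFunLike.congr_fun h G

/-- The linear form with given coefficients. -/
def linForm : (Fin n → ℂ) →ₗ[ℂ] MvPolynomial (Fin n) ℂ :=
  Fintype.linearCombination ℂ X

theorem linForm_apply (a : Fin n → ℂ) : linForm a = ∑ k, C (a k) * X k := by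
  simp [linForm, Fintype.linearCombination_apply, smul_eq_C_mul]

theorem linForm_isHomogeneous (a : Fin n → ℂ) : (linForm a).IsHomogeneous 1 := by
  rw [linForm_apply]
  refine IsHomogeneous.sum _ _ _ fun k _ => ?_
  simpa using (isHomogeneous_C _ (a k)).mul (isHomogeneous_X ℂ k)

theorem lineEval_linForm (v x a : Fin n → ℂ) :
    lineEval v x (linForm a) =
      Polynomial.C (a ⬝ᵥ v) + Polynomial.C (a ⬝ᵥ x) * Polynomial.X := by
  simp only [linForm_apply, map_sum, map_mul, lineEval_X, algHom_C, Polynomial.algebraMap_eq,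
    dotProduct, mul_add, Finset.sum_add_distrib, Finset.sum_mul, mul_assoc]

/-- A form of degree `d + 2` with the `2`-jet `a² + L (m + c)` at the `j`-th coordinate point. -/
def modelForm (d : ℕ) (j : Fin n) (c : ℂ) (a L m : Fin n → ℂ) : MvPolynomial (Fin n) ℂ :=
  X j ^ d * (linForm a ^ 2 + linForm L * (linForm m + C c * X j))

theorem modelForm_isHomogeneous (d : ℕ) (j : Fin n) (c : ℂ) (a L m : Fin n → ℂ) :
    (modelForm d j c a L m).IsHomogeneous (d + 2) := by
  have h1 : (X j ^ d : MvPolynomial (Fin n) ℂ).IsHomogeneous d := by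
    simpa using (isHomogeneous_X ℂ j).pow d
  have h2 : (linForm a ^ 2).IsHomogeneous 2 := by
    simpa using (linForm_isHomogeneous a).pow 2
  have h3 : (C c * X j : MvPolynomial (Fin n) ℂ).IsHomogeneous 1 := by
    simpa using (isHomogeneous_C _ c).mul (isHomogeneous_X ℂ j)
  exact h1.mul (h2.add ((linForm_isHomogeneous L).mul ((linForm_isHomogeneous m).add h3)))

theorem hessAt_modelForm (d : ℕ) {j : Fin n} (c : ℂ) {a L m : Fin n → ℂ} (ha : a j = 0)
    (hL : L j = 0) (hm : m j = 0) (x : Fin n → ℂ) :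
    hessAt (modelForm d j c a L m) (Pi.single j 1) x x =
      (a ⬝ᵥ x) ^ 2 + (L ⬝ᵥ x) * (m ⬝ᵥ x + (d + 1) * c * x j) := by
  have h : lineEval (Pi.single j 1) x (modelForm d j c a L m) =
      (1 + Polynomial.C (x j) * Polynomial.X) ^ d *
        (Polynomial.C (L ⬝ᵥ x * c) + Polynomial.C ((a ⬝ᵥ x) ^ 2 + (L ⬝ᵥ x) *
          (m ⬝ᵥ x + c * x j)) * Polynomial.X) * Polynomial.X := by
    simp only [modelForm, map_mul, map_pow, map_add, lineEval_linForm, lineEval_X,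
      dotProduct_single, ha, hL, hm, algHom_C, Polynomial.algebraMap_eq, Pi.single_eq_same, map_one,
      zero_mul, map_zero]
    ring
  rw [← lineEval_coeff_two, h, Polynomial.coeff_mul_X, Polynomial.mul_coeff_one]
  have h0 : ((1 + Polynomial.C (x j) * Polynomial.X) ^ d).coeff 0 = 1 := by
    simp [Polynomial.coeff_zero_eq_eval_zero]
  have h1 : ((1 + Polynomial.C (x j) * Polynomial.X) ^ d).coeff 1 = d * x j := by
    have := Polynomial.coeff_derivative ((1 + Polynomial.C (x j) * Polynomial.X) ^ d) 0
    simp only [Polynomial.derivative_pow, Polynomial.coeff_zero_eq_eval_zero] at this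
    simpa using this.symm
  have h2 (e f : ℂ) : (Polynomial.C f + Polynomial.C e * Polynomial.X).coeff 0 = f := by simp
  have h3 (e f : ℂ) : (Polynomial.C f + Polynomial.C e * Polynomial.X).coeff 1 = e := by
    simp [Polynomial.coeff_C]
  rw [h0, h1, h2, h3]
  ring

theorem eval_single_of_isHomogeneous {p : MvPolynomial (Fin n) ℂ} {d : ℕ} (hp : p.IsHomogeneous d)
    (j : Fin n) : eval (Pi.single j 1) p = coeff (Finsupp.single j d) p := by
  rw [eval_eq', Finset.sum_eq_single (Finsupp.single j d)]
  · rw [Finset.prod_eq_one, mul_one]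
    intro i _
    rcases eq_or_ne i j with rfl | h
    · simp
    · simp [h]
  · intro α hα hne
    have hd : Finsupp.weight (fun _ => 1) α = d := hp (mem_support_iff.1 hα)
    rw [← Finsupp.degree_eq_weight_one, Finsupp.degree_eq_sum] at hd
    obtain ⟨i, hij, hi⟩ : ∃ i, i ≠ j ∧ α i ≠ 0 := by
      by_contra! h
      rw [Finset.sum_eq_single j (fun i _ hi => h i hi) (by simp)] at hd
      refine hne (Finsupp.ext fun i => ?_)
      rcases eq_or_ne i j with rfl | hi
      · simp [hd]
      · simp [h i hi, hi]
    rw [Finset.prod_eq_zero (Finset.mem_univ i) (by simp [hij, hi]), mul_zero]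
  · intro h
    rw [notMem_support_iff.1 h, zero_mul]

theorem coeff_eq_zero_of_hessAt {K : MvPolynomial (Fin n) ℂ} {d : ℕ}
    (hK : K.IsHomogeneous (d + 2)) {j : Fin n}
    (h : ∀ x, hessAt K (Pi.single j 1) x x = 0) (a b : Fin n) :
    coeff (Finsupp.single j d + (Finsupp.single a 1 + Finsupp.single b 1)) K = 0 := by
  have hB := hessAt_isSymm K (Pi.single j 1)
  have hab : hessAt K (Pi.single j 1) (Pi.single a 1) (Pi.single b 1) = 0 := by
    have h1 := h (Pi.single a 1 + Pi.single b 1)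
    have h2 := hB.eq (Pi.single a 1) (Pi.single b 1)
    simp only [map_add, LinearMap.add_apply, h, ← h2] at h1
    linear_combination h1 / 2
  have hH : (pderiv a (pderiv b K)).IsHomogeneous d := (hK.pderiv (i := b)).pderiv
  rw [hessAt, Matrix.toBilin'_single, Matrix.of_apply, eval_single_of_isHomogeneous hH,
    coeff_pderiv, coeff_pderiv] at hab
  rw [← add_assoc]
  have hne (x : ℕ) : (x : ℂ) + 1 ≠ 0 := Nat.cast_add_one_ne_zero x
  simpa only [div_eq_zero_iff, mul_eq_zero, hne, or_false, OfNat.ofNat_ne_zero] using hab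

end Shear

section Parametrisation

instance (M : ℕ) : FiniteDimensional ℂ (WSpace M) :=
  Module.Finite.iff_fg.2 (homogeneousSubmodule_fg _ _ _)

theorem support_subset_of_isHomogeneous {n d : ℕ} {p : MvPolynomial (Fin n) ℂ}
    (hp : p.IsHomogeneous d) : p.support ⊆ Finset.univ.finsuppAntidiag d := fun α hα => by
  have h : Finsupp.weight (fun _ => 1) α = d := hp (mem_support_iff.1 hα)
  rw [← Finsupp.degree_eq_weight_one, Finsupp.degree_eq_sum] at h
  exact Finset.mem_finsuppAntidiag.2 ⟨h, Finset.subset_univ _⟩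

theorem IsPolyMap.isPolyFun_linear {P : Type*} [AddCommGroup P] [Module ℂ P] {M : ℕ}
    {F : P → WSpace M} (hF : IsPolyMap fun v => (F v : MvPolynomial (Fin (M + 1)) ℂ))
    (φ : WSpace M →ₗ[ℂ] ℂ) : IsPolyFun fun v => φ (F v) := by
  obtain ⟨Φ, hΦ⟩ := LinearMap.exists_extend φ
  have h (v : P) : φ (F v) = ∑ α ∈ Finset.univ.finsuppAntidiag (2 * M),
      coeff α (F v : MvPolynomial (Fin (M + 1)) ℂ) * Φ (monomial α 1) := by
    rw [← hΦ, LinearMap.comp_apply, Submodule.subtype_apply]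
    conv_lhs => rw [as_sum (F v : MvPolynomial (Fin (M + 1)) ℂ)]
    rw [map_sum]
    refine (Finset.sum_subset (support_subset_of_isHomogeneous (F v).2) fun α _ hα => ?_).trans
      (Finset.sum_congr rfl fun α _ => ?_)
    · rw [notMem_support_iff.1 hα, monomial_zero, map_zero]
    · rw [← smul_eq_mul (a := coeff α _), ← map_smul, smul_monomial, smul_eq_mul, mul_one]
  simp only [h]
  exact IsPolyFun.sum (f := fun (α : Fin (M + 1) →₀ ℕ) v =>
    coeff α (F v : MvPolynomial (Fin (M + 1)) ℂ) * Φ (monomial α 1)) fun α _ =>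
      (hF α).mul (IsPolyFun.const _)

variable {n : ℕ}

/-- Extension of a vector by zero outside the coordinates satisfying `p`. -/
def extZero (p : Fin n → Prop) : ({k // p k} → ℂ) →ₗ[ℂ] (Fin n → ℂ) :=
  Function.ExtendByZero.linearMap ℂ Subtype.val

theorem extZero_of_not {p : Fin n → Prop} (u : {k // p k} → ℂ) {k : Fin n} (hk : ¬ p k) :
    extZero p u k = 0 := by
  rw [extZero, Function.ExtendByZero.linearMap_apply, Function.extend_apply']
  · rfl
  · rintro ⟨a, rfl⟩
    exact hk a.2

theorem extZero_restrict {p : Fin n → Prop} {u : Fin n → ℂ} (hu : ∀ k, ¬ p k → u k = 0) :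
    extZero p (fun k => u k) = u := by
  ext k
  by_cases hk : p k
  · rw [extZero, Function.ExtendByZero.linearMap_apply]
    exact Subtype.val_injective.extend_apply (fun k : {k // p k} => u k) 0 ⟨k, hk⟩
  · rw [extZero_of_not _ hk, hu k hk]

variable {M : ℕ}

/-- The coefficients of order two of a form at the `j`-th coordinate point. -/
def jetMap (M : ℕ) (j : Fin (M + 1)) : WSpace M →ₗ[ℂ] (Sym (Fin (M + 1)) 2 → ℂ) :=
  LinearMap.pi fun s => lcoeff ℂ (Finsupp.single j (2 * M - 2) + Multiset.toFinsupp s.1) ∘ₗ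
    (homogeneousSubmodule (Fin (M + 1)) ℂ (2 * M)).subtype

theorem jetMap_apply (j : Fin (M + 1)) (G : WSpace M) (s : Sym (Fin (M + 1)) 2) :
    jetMap M j G s = coeff (Finsupp.single j (2 * M - 2) + Multiset.toFinsupp s.1)
      (G : MvPolynomial (Fin (M + 1)) ℂ) := rfl

theorem jetMap_surjective (hM : 1 ≤ M) (j : Fin (M + 1)) :
    Function.Surjective (jetMap M j) := by
  intro f
  have hdeg (s : Sym (Fin (M + 1)) 2) :
      (Finsupp.single j (2 * M - 2) + Multiset.toFinsupp s.1).degree = 2 * M := by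
    rw [map_add, Finsupp.degree_single, Finsupp.degree_apply, Multiset.toFinsupp_support]
    have : ∑ i ∈ s.1.toFinset, Multiset.toFinsupp s.1 i = 2 := by
      simp only [Multiset.toFinsupp_apply]
      rw [Multiset.toFinset_sum_count_eq]
      exact s.2
    omega
  refine ⟨⟨∑ s, monomial (Finsupp.single j (2 * M - 2) + Multiset.toFinsupp s.1) (f s),
    Submodule.sum_mem _ fun s _ => isHomogeneous_monomial _ (hdeg s)⟩, ?_⟩
  ext s
  rw [jetMap_apply, coeff_sum, Finset.sum_eq_single s]
  · simp
  · intro t _ hts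
    rw [coeff_monomial, if_neg]
    intro h
    exact hts (Subtype.ext (Multiset.toFinsupp.injective (add_left_cancel h)))
  · simp

/-- The forms with vanishing terms of order two at the `j`-th coordinate point. -/
def JetKer (M : ℕ) (j : Fin (M + 1)) : Type := LinearMap.ker (jetMap M j)

instance (j : Fin (M + 1)) : AddCommGroup (JetKer M j) :=
  inferInstanceAs (AddCommGroup (LinearMap.ker (jetMap M j)))

instance (j : Fin (M + 1)) : Module ℂ (JetKer M j) :=
  inferInstanceAs (Module ℂ (LinearMap.ker (jetMap M j)))

instance (j : Fin (M + 1)) : FiniteDimensional ℂ (JetKer M j) :=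
  inferInstanceAs (FiniteDimensional ℂ (LinearMap.ker (jetMap M j)))

/-- The inclusion of the forms with vanishing terms of order two. -/
def jetKerIncl (j : Fin (M + 1)) : JetKer M j →ₗ[ℂ] MvPolynomial (Fin (M + 1)) ℂ :=
  (homogeneousSubmodule (Fin (M + 1)) ℂ (2 * M)).subtype ∘ₗ (LinearMap.ker (jetMap M j)).subtype

theorem jetKerIncl_isHomogeneous (j : Fin (M + 1)) (R : JetKer M j) :
    (jetKerIncl j R).IsHomogeneous (2 * M) :=
  Subtype.prop (Subtype.val (p := fun G : WSpace M => G ∈ LinearMap.ker (jetMap M j)) R)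

theorem exists_jetKerIncl_eq {j : Fin (M + 1)} {K : MvPolynomial (Fin (M + 1)) ℂ}
    (hK : K.IsHomogeneous (2 * M))
    (h : ∀ a b, coeff (Finsupp.single j (2 * M - 2) + (Finsupp.single a 1 + Finsupp.single b 1)) K =
      0) : ∃ R : JetKer M j, jetKerIncl j R = K := by
  refine ⟨(⟨⟨K, (mem_homogeneousSubmodule _ _).2 hK⟩, ?_⟩ : LinearMap.ker (jetMap M j)), rfl⟩
  rw [LinearMap.mem_ker]
  ext s
  obtain ⟨a, b, hs⟩ := Multiset.card_eq_two.1 s.2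
  rw [jetMap_apply, Pi.zero_apply, ← h a b]
  change coeff (_ + Multiset.toFinsupp s.1) K = _
  rw [hs]
  congr 2
  rw [Multiset.insert_eq_cons, ← Multiset.singleton_add, map_add, Multiset.toFinsupp_singleton,
    Multiset.toFinsupp_singleton]

theorem finrank_jetKer (hM : 1 ≤ M) (j : Fin (M + 1)) :
    (M + 2).choose 2 + Module.finrank ℂ (JetKer M j) = Module.finrank ℂ (WSpace M) := by
  rw [← (jetMap M j).finrank_range_add_finrank_ker,
    LinearMap.range_eq_top.2 (jetMap_surjective hM j), finrank_top,
    Module.finrank_fintype_fun_eq_card, Sym.card_sym_eq_choose, Fintype.card_fin]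
  rfl

/-- The parameters of a form with a degenerate point. -/
abbrev ParamSpace (M : ℕ) (j i : Fin (M + 1)) :=
  ({k // k ≠ j} → ℂ) × ({k // k ≠ j} → ℂ) × ({k // k ≠ j} → ℂ) × ({k // k ≠ j ∧ k ≠ i} → ℂ) ×
    JetKer M j

theorem finrank_paramSpace (hM : 4 ≤ M) {j i : Fin (M + 1)} (hij : i ≠ j) :
    Module.finrank ℂ (ParamSpace M j i) + (M - 4) * (M - 1) / 2 =
      Module.finrank ℂ (WSpace M) := by
  have h1 : Fintype.card {k : Fin (M + 1) // k ≠ j} = M := by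
    simp [Fintype.card_subtype_compl]
  have h2 : Fintype.card {k : Fin (M + 1) // k ≠ j ∧ k ≠ i} = M - 1 := by
    have : (Finset.univ.filter fun k => k ≠ j ∧ k ≠ i) =
        (Finset.univ.erase j).erase i := by
      ext k
      simp [and_comm]
    rw [Fintype.card_subtype, this, Finset.card_erase_of_mem (by simp [hij]),
      Finset.card_erase_of_mem (by simp)]
    simp
  have h3 := finrank_jetKer (by omega : 1 ≤ M) j
  rw [Module.finrank_prod, Module.finrank_prod, Module.finrank_prod,
    Module.finrank_prod, Module.finrank_fintype_fun_eq_card, Module.finrank_fintype_fun_eq_card,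
    h1, h2]
  rw [← h3, Nat.choose_two_right]
  obtain ⟨m, rfl⟩ := Nat.exists_eq_add_of_le hM
  have e1 : 4 + m + 2 - 1 = m + 5 := by omega
  have e2 : 4 + m - 4 = m := by omega
  have e3 : 4 + m - 1 = m + 3 := by omega
  rw [e1, e2, e3]
  have e4 : (4 + m + 2) * (m + 5) = m * (m + 3) + 2 * (4 * m + 15) := by ring
  rw [e4, Nat.add_mul_div_left _ _ two_pos]
  omega

/-- The form with given parameters. -/
def paramForm (j i : Fin (M + 1)) (c : ℂ) (p : ParamSpace M j i) :
    MvPolynomial (Fin (M + 1)) ℂ :=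
  shear j (-extZero _ p.1) (modelForm (2 * M - 2) j c (extZero _ p.2.2.2.1) (extZero _ p.2.1)
    (extZero _ p.2.2.1) + jetKerIncl j p.2.2.2.2)

theorem modelForm_add_isHomogeneous (hM : 1 ≤ M) (j : Fin (M + 1)) (c : ℂ)
    (a L m : Fin (M + 1) → ℂ) (R : JetKer M j) :
    (modelForm (2 * M - 2) j c a L m + jetKerIncl j R).IsHomogeneous (2 * M) := by
  have h := modelForm_isHomogeneous (2 * M - 2) j c a L m
  rw [Nat.sub_add_cancel (by omega)] at h
  exact h.add (jetKerIncl_isHomogeneous j R)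

theorem paramForm_isHomogeneous (hM : 1 ≤ M) (j i : Fin (M + 1)) (c : ℂ) (p : ParamSpace M j i) :
    (paramForm j i c p).IsHomogeneous (2 * M) :=
  shear_isHomogeneous _ _ (modelForm_add_isHomogeneous hM _ _ _ _ _ _)

theorem IsPolyMap.shear {P : Type*} [AddCommGroup P] [Module ℂ P] {j : Fin (M + 1)}
    (w : P →ₗ[ℂ] (Fin (M + 1) → ℂ)) {F : P → MvPolynomial (Fin (M + 1)) ℂ} {d : ℕ}
    (hF : IsPolyMap F) (hd : ∀ p, (F p).IsHomogeneous d) :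
    IsPolyMap fun p => shear j (w p) (F p) := by
  have hw (k : Fin (M + 1)) : IsPolyMap fun p => (X k + C (w p k) * X j :
      MvPolynomial (Fin (M + 1)) ℂ) := by
    have h : IsPolyFun fun p => w p k := IsPolyFun.of_linear (LinearMap.proj k ∘ₗ w)
    exact (IsPolyMap.const _).add ((IsPolyMap.C_comp h).mul (IsPolyMap.const _))
  exact IsPolyMap.bind₁ (g := fun p k => X k + C (w p k) * X j) hw hF _ fun p =>
    support_subset_of_isHomogeneous (hd p)

theorem isPolyMap_modelForm {P : Type*} [AddCommGroup P] [Module ℂ P] (d : ℕ) (j : Fin n) (c : ℂ)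
    (a L m : P →ₗ[ℂ] (Fin n → ℂ)) : IsPolyMap fun p => modelForm d j c (a p) (L p) (m p) := by
  have h (f : P →ₗ[ℂ] (Fin n → ℂ)) : IsPolyMap fun p => linForm (f p) :=
    IsPolyMap.of_linear (linForm ∘ₗ f)
  exact (IsPolyMap.const _).mul (((h a).pow 2).add ((h L).mul ((h m).add (IsPolyMap.const _))))

theorem isPolyMap_paramForm (hM : 1 ≤ M) (j i : Fin (M + 1)) (c : ℂ) :
    IsPolyMap (paramForm j i c) := by
  let π₁ : ParamSpace M j i →ₗ[ℂ] ({k // k ≠ j} → ℂ) := LinearMap.fst ℂ _ _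
  let ρ₁ : ParamSpace M j i →ₗ[ℂ] ({k // k ≠ j} → ℂ) × ({k // k ≠ j} → ℂ) ×
    ({k // k ≠ j ∧ k ≠ i} → ℂ) × JetKer M j := LinearMap.snd ℂ _ _
  let ρ₂ : ParamSpace M j i →ₗ[ℂ] ({k // k ≠ j} → ℂ) × ({k // k ≠ j ∧ k ≠ i} → ℂ) × JetKer M j :=
    LinearMap.snd ℂ _ _ ∘ₗ ρ₁
  let ρ₃ : ParamSpace M j i →ₗ[ℂ] ({k // k ≠ j ∧ k ≠ i} → ℂ) × JetKer M j :=
    LinearMap.snd ℂ _ _ ∘ₗ ρ₂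
  have hR := IsPolyMap.of_linear (jetKerIncl j ∘ₗ LinearMap.snd ℂ _ _ ∘ₗ ρ₃)
  have hH := isPolyMap_modelForm (2 * M - 2) j c (extZero _ ∘ₗ LinearMap.fst ℂ _ _ ∘ₗ ρ₃)
    (extZero _ ∘ₗ LinearMap.fst ℂ _ _ ∘ₗ ρ₁) (extZero _ ∘ₗ LinearMap.fst ℂ _ _ ∘ₗ ρ₂)
  exact (hH.add hR).shear (-(extZero _ ∘ₗ π₁)) fun p => modelForm_add_isHomogeneous hM _ _ _ _ _ _

end Parametrisation

section Locus

variable {n M : ℕ}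

theorem linearMap_apply_eq_dotProduct (f : (Fin n → ℂ) →ₗ[ℂ] ℂ) (x : Fin n → ℂ) :
    f x = (fun k => f (Pi.single k 1)) ⬝ᵥ x := by
  conv_lhs => rw [pi_eq_sum_univ' x]
  simp [dotProduct, mul_comm]

/-- A form of degree `2M` with a point of rank at most `3` belongs to one of the families
`paramForm`. -/
theorem exists_paramForm_eq (hM : 1 ≤ M) {G : MvPolynomial (Fin (M + 1)) ℂ}
    (hG : G.IsHomogeneous (2 * M)) {v : Fin (M + 1) → ℂ} {j : Fin (M + 1)} (hv : v j = 1)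
    (h : HasNormalForm (hessAt G v) v j) :
    ∃ (i : Fin (M + 1)) (ε : Fin 2) (p : ParamSpace M j i),
      i ≠ j ∧ paramForm j i ((ε : ℕ) / (2 * M - 1)) p = G := by
  obtain ⟨i, ε, a, L, m, hij, hav, hLv, hmv, hai, hB⟩ := h
  set w : Fin (M + 1) → ℂ := v - Pi.single j 1 with hw
  have hwj : w j = 0 := by simp [hw, hv]
  have hvw : Pi.single j 1 + w = v := by simp [hw]
  let A : (Fin (M + 1) → ℂ) →ₗ[ℂ] (Fin (M + 1) → ℂ) :=
    LinearMap.id + (LinearMap.proj j).smulRight w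
  have hA (x : Fin (M + 1) → ℂ) : A x = x + x j • w := by simp [A]
  have hAj : A (Pi.single j 1) = v := by rw [hA]; simp [hvw]
  have hAi : A (Pi.single i 1) = Pi.single i 1 := by rw [hA]; simp [hij.symm]
  let α : Fin (M + 1) → ℂ := fun k => a (A (Pi.single k 1))
  let l : Fin (M + 1) → ℂ := fun k => L (A (Pi.single k 1))
  let μ : Fin (M + 1) → ℂ := Function.update (fun k => m (A (Pi.single k 1))) j 0
  have hα (x : Fin (M + 1) → ℂ) : a (A x) = α ⬝ᵥ x := linearMap_apply_eq_dotProduct (a ∘ₗ A) x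
  have hl (x : Fin (M + 1) → ℂ) : L (A x) = l ⬝ᵥ x := linearMap_apply_eq_dotProduct (L ∘ₗ A) x
  have hμ (x : Fin (M + 1) → ℂ) : m (A x) = μ ⬝ᵥ x + (ε : ℕ) * x j := by
    have h : (fun k => m (A (Pi.single k 1))) = μ + Pi.single j ((ε : ℕ) : ℂ) := by
      ext k
      rcases eq_or_ne k j with rfl | hk
      · simp [μ, hAj, hmv]
      · simp [μ, hk]
    rw [← single_dotProduct, ← add_dotProduct, ← h]
    exact linearMap_apply_eq_dotProduct (m ∘ₗ A) x
  have hαj : α j = 0 := by simp [α, hAj, hav]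
  have hαi : α i = 0 := by simp only [α]; rw [hAi, hai]
  have hlj : l j = 0 := by simp [l, hAj, hLv]
  have hμj : μ j = 0 := by simp [μ]
  have hM' : ((2 * M - 2 : ℕ) : ℂ) + 1 = 2 * M - 1 := by
    rw [Nat.cast_sub (by omega)]
    push_cast
    ring
  have hM0 : (2 * M - 1 : ℂ) ≠ 0 := by
    rw [← hM']
    exact Nat.cast_add_one_ne_zero _
  set c : ℂ := (ε : ℕ) / (2 * M - 1) with hc
  have hmodel := modelForm_isHomogeneous (2 * M - 2) j c α l μ
  have hK : (shear j w G - modelForm (2 * M - 2) j c α l μ).IsHomogeneous (2 * M - 2 + 2) :=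
    IsHomogeneous.sub (by
      rw [Nat.sub_add_cancel (by omega)]
      exact shear_isHomogeneous j w hG) hmodel
  have hess (x : Fin (M + 1) → ℂ) :
      hessAt (shear j w G - modelForm (2 * M - 2) j c α l μ) (Pi.single j 1) x x = 0 := by
    rw [← lineEval_coeff_two, map_sub, Polynomial.coeff_sub, lineEval_coeff_two (G := modelForm ..),
      hessAt_modelForm _ _ hαj hlj hμj, lineEval_shear, Pi.single_eq_same, one_smul, hvw, ← hA,
      lineEval_coeff_two, hB, hα, hl, hμ, hM', hc, mul_div_cancel₀ _ hM0, sub_self]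
  obtain ⟨R, hR⟩ := exists_jetKerIncl_eq (Nat.sub_add_cancel (by omega : 2 ≤ 2 * M) ▸ hK)
    (coeff_eq_zero_of_hessAt hK hess)
  refine ⟨i, ε, (fun k => w k, fun k => l k, fun k => μ k, fun k => α k, R), hij, ?_⟩
  have hne {u : Fin (M + 1) → ℂ} (hu : u j = 0) (k : Fin (M + 1)) (hk : ¬ k ≠ j) : u k = 0 := by
    rw [not_not.1 hk, hu]
  have hne' (k : Fin (M + 1)) (hk : ¬ (k ≠ j ∧ k ≠ i)) : α k = 0 := by
    rcases eq_or_ne k j with rfl | hkj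
    · exact hαj
    · rwa [not_not.1 fun hki => hk ⟨hkj, hki⟩]
  rw [paramForm, extZero_restrict (hne hwj), extZero_restrict (hne hlj), extZero_restrict (hne hμj),
    extZero_restrict hne', hR, add_sub_cancel, shear_neg_shear hwj]

theorem zdim_not_wRegular_le (hM : 4 ≤ M) :
    zdim {W : WSpace M | ¬ WRegular (W : MvPolynomial (Fin (M + 1)) ℂ)} ≤
      ((Module.finrank ℂ (WSpace M) - (M - 4) * (M - 1) / 2 : ℕ) : WithBot ℕ∞) := by
  have hM1 : 1 ≤ M := by omega
  let F (k : {k : Fin (M + 1) × Fin (M + 1) // k.2 ≠ k.1} × Fin 2)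
      (p : ParamSpace M k.1.1.1 k.1.1.2) : WSpace M :=
    ⟨paramForm k.1.1.1 k.1.1.2 ((k.2 : ℕ) / (2 * M - 1)) p,
      (mem_homogeneousSubmodule _ _).2 (paramForm_isHomogeneous hM1 _ _ _ p)⟩
  refine zdim_le_of_subset_iUnion_range F (fun k φ =>
    IsPolyMap.isPolyFun_linear (F := F k) (isPolyMap_paramForm hM1 _ _ _) φ) (fun W hW => ?_)
    fun k => ?_
  · have hG : (W : MvPolynomial (Fin (M + 1)) ℂ).IsHomogeneous (2 * M) := W.2
    obtain ⟨v, j, hv, hGv, hr⟩ := (not_wRegular_iff hM1 hG).1 hW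
    obtain ⟨i, ε, p, hij, hp⟩ := exists_paramForm_eq hM1 hG hv
      ((regular_iff hG (by omega) (by omega) hv hGv).2 hr)
    exact Set.mem_iUnion.2 ⟨(⟨(j, i), hij⟩, ε), p, Subtype.ext hp⟩
  · have := finrank_paramSpace hM k.1.2
    omega

end Locus

/-- Proposition 2.3: for `M ≥ 5` the set
`𝒲_reg = {W | W satisfies (W1) at every non-singular and (W2) at every singular point}`
is Zariski open in the space `𝒲` of hypersurfaces of degree `2M` in `ℙ^M`, and its
complement has codimension at least `(M−4)(M−1)/2`. -/
theorem double_space_regular_locus (M : ℕ) (hM : 5 ≤ M) :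
    IsZOpen {W : WSpace M | WRegular (W : MvPolynomial (Fin (M + 1)) ℂ)} ∧
    zdim {W : WSpace M | ¬ WRegular (W : MvPolynomial (Fin (M + 1)) ℂ)}
        + (((M - 4) * (M - 1) / 2 : ℕ) : ℕ∞)
      ≤ ((Module.finrank ℂ (WSpace M) : ℕ∞) : WithBot ℕ∞) := by
  refine ⟨isZOpen_wRegular (by omega), ?_⟩
  have h0 : (0 : Fin (M + 1)) ≠ Fin.last M := by
    rw [Ne, Fin.ext_iff, Fin.val_zero, Fin.val_last]
    omega
  have h := finrank_paramSpace (by omega : 4 ≤ M) h0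
  have hle := zdim_not_wRegular_le (by omega : 4 ≤ M)
  rw [← h, Nat.add_sub_cancel] at hle
  rw [← h]
  exact (add_le_add_left hle _).trans_eq (by norm_cast)
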